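/- arXiv:1510.04712 — 11 statements merged into one kernel-verified Lean document; each statement's English description precedes it below -/
import Mathlib

section
/- Let A ∈ ℝ^{n×n}, B ∈ ℝ^{n×p}, C ∈ ℝ^{m×n}, D ∈ ℝ^{m×p}. The discrete-time system x(k+1) = A x(k) + B u(k), y(k) = C x(k) + D u(k) with x(0) = 0 is left invertible if and only if the matrix C (zI − A)^{-1} B + D, viewed as an m × p matrix over the field ℝ(z) of real rational functions, has rank equal to p. -/
/-- The discrete-time system `(A, B, C, D)` is left invertible if, starting from
`x 0 = 0`, a zero output sequence forces a zero input sequence. -/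
def LeftInvertible {n p m : ℕ} (A : Matrix (Fin n) (Fin n) ℝ) (B : Matrix (Fin n) (Fin p) ℝ)
    (C : Matrix (Fin m) (Fin n) ℝ) (D : Matrix (Fin m) (Fin p) ℝ) : Prop :=
  ∀ (x : ℕ → Fin n → ℝ) (u : ℕ → Fin p → ℝ),
    x 0 = 0 →
    (∀ k, x (k + 1) = A.mulVec (x k) + B.mulVec (u k)) →
    (∀ k, C.mulVec (x k) + D.mulVec (u k) = 0) →
    ∀ k, u k = 0

/-- The transfer function `C (zI - A)⁻¹ B + D`, viewed as an `m × p` matrix over the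
field `ℝ(z)` of real rational functions (`z = RatFunc.X`). -/
noncomputable def transferMatrix {n p m : ℕ} (A : Matrix (Fin n) (Fin n) ℝ)
    (B : Matrix (Fin n) (Fin p) ℝ) (C : Matrix (Fin m) (Fin n) ℝ)
    (D : Matrix (Fin m) (Fin p) ℝ) : Matrix (Fin m) (Fin p) (RatFunc ℝ) :=
  C.map (algebraMap ℝ (RatFunc ℝ)) *
      (Matrix.scalar (Fin n) (RatFunc.X : RatFunc ℝ) -
        A.map (algebraMap ℝ (RatFunc ℝ)))⁻¹ *
      B.map (algebraMap ℝ (RatFunc ℝ)) +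
    D.map (algebraMap ℝ (RatFunc ℝ))

open LaurentSeries in
/-- The embedding of `ℝ(z)` into formal Laurent series which expands a rational function at
infinity, i.e. sends `z` to the inverse of the formal variable. -/
noncomputable def expandAtInfinity : RatFunc ℝ →ₐ[ℝ] ℝ⸨X⸩ :=
  RatFunc.liftAlgHom (Polynomial.aeval (HahnSeries.single (-1 : ℤ) (1 : ℝ)))
    (nonZeroDivisors_le_comap_nonZeroDivisors_of_injective _ (by
      have hX : Transcendental ℝ (HahnSeries.single (1 : ℤ) (1 : ℝ) : ℝ⸨X⸩) := by
        have := IsScalarTower.of_algebraMap_eq (R := ℝ) (S := Polynomial ℝ) (A := ℝ⸨X⸩) fun r => by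
          simp [HahnSeries.algebraMap_apply', PowerSeries.algebraMap_apply']
        have h := (transcendental_algebraMap_iff (Polynomial.algebraMap_hahnSeries_injective
          (R := ℝ) ℤ)).2 (Polynomial.transcendental_X ℝ)
        simpa [Polynomial.algebraMap_hahnSeries_apply] using h
      have hinv : (HahnSeries.single (-1 : ℤ) (1 : ℝ) : ℝ⸨X⸩) =
          (HahnSeries.single (1 : ℤ) (1 : ℝ))⁻¹ := by
        simp
      refine transcendental_iff_injective.1 ?_
      rw [hinv]
      exact fun h => hX (IsAlgebraic.inv_iff.1 h)))

theorem expandAtInfinity_X :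
    expandAtInfinity RatFunc.X = HahnSeries.single (-1 : ℤ) (1 : ℝ) := by
  have h := RatFunc.liftRingHom_algebraMap
    (Polynomial.aeval (R := ℝ) (HahnSeries.single (-1 : ℤ) (1 : ℝ))).toRingHom
    (K := ℝ) (hφ := ?_) Polynomial.X
  · rw [RatFunc.algebraMap_X] at h
    exact h.trans (Polynomial.aeval_X _)

/-- A matrix over a field has full column rank iff it acts injectively on vectors. -/
theorem Matrix.rank_eq_width_iff_mulVec_injective {K : Type*} [Field K] {m p : ℕ}
    (M : Matrix (Fin m) (Fin p) K) : M.rank = p ↔ Function.Injective M.mulVec := by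
  have h := M.mulVecLin.finrank_range_add_finrank_ker
  rw [Module.finrank_fin_fun] at h
  change _ ↔ Function.Injective M.mulVecLin
  rw [← LinearMap.ker_eq_bot, ← Submodule.finrank_eq_zero (R := K), Matrix.rank]
  omega

/-- Injectivity of a matrix over a field is preserved under field extensions. -/
theorem Matrix.mulVec_map_injective {K L : Type*} [Field K] [Field L] (f : K →+* L) {m p : ℕ}
    {M : Matrix (Fin m) (Fin p) K} (hM : Function.Injective M.mulVec) :
    Function.Injective (M.map f).mulVec := by
  obtain ⟨g, hg⟩ := (Matrix.toLin' M).exists_leftInverse_of_injective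
    (LinearMap.ker_eq_bot.2 hM)
  have hN : LinearMap.toMatrix' g * M = 1 := by
    rw [← LinearMap.toMatrix'_toLin' M, ← LinearMap.toMatrix'_comp, hg, LinearMap.toMatrix'_id]
  have hN' : (LinearMap.toMatrix' g).map f * M.map f = 1 := by
    rw [← Matrix.map_mul, hN, Matrix.map_one _ f.map_zero f.map_one]
  exact Function.LeftInverse.injective (g := ((LinearMap.toMatrix' g).map f).mulVec) fun v => by
    rw [Matrix.mulVec_mulVec, hN', Matrix.one_mulVec]

open LaurentSeries in
/-- The generating function of a sequence of vectors. -/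
noncomputable def generatingSeries {ι : Type*} (s : ℕ → ι → ℝ) (i : ι) : ℝ⸨X⸩ :=
  HahnSeries.ofPowerSeries ℤ ℝ (PowerSeries.mk fun k => s k i)

theorem generatingSeries_injective {ι : Type*} :
    Function.Injective (generatingSeries : (ℕ → ι → ℝ) → _) := by
  intro s t h
  ext k i
  simpa using congrArg (PowerSeries.coeff k)
    (HahnSeries.ofPowerSeries_injective (congrFun h i))

theorem generatingSeries_zero {ι : Type*} :
    generatingSeries (fun _ => (0 : ι → ℝ)) = 0 := by
  ext1 i
  exact (congrArg _ (PowerSeries.ext fun k => by simp)).trans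
    (map_zero (HahnSeries.ofPowerSeries ℤ ℝ))

theorem generatingSeries_add {ι : Type*} (s t : ℕ → ι → ℝ) :
    generatingSeries (fun k => s k + t k) = generatingSeries s + generatingSeries t := by
  ext1 i
  simp only [generatingSeries, Pi.add_apply, ← map_add]
  congr 1

open LaurentSeries in
theorem generatingSeries_mulVec {m p : ℕ} (M : Matrix (Fin m) (Fin p) ℝ) (s : ℕ → Fin p → ℝ) :
    generatingSeries (fun k => M.mulVec (s k)) =
      (M.map (algebraMap ℝ ℝ⸨X⸩)).mulVec (generatingSeries s) := by
  ext1 i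
  have hC (r : ℝ) : algebraMap ℝ ℝ⸨X⸩ r = HahnSeries.ofPowerSeries ℤ ℝ (PowerSeries.C r) := by
    simp [HahnSeries.algebraMap_apply']
  simp only [generatingSeries, Matrix.mulVec, dotProduct, Matrix.map_apply, hC, ← map_mul,
    ← map_sum]
  congr 1
  ext k
  simp [map_sum]

theorem single_smul_generatingSeries {ι : Type*} (s : ℕ → ι → ℝ) (h0 : s 0 = 0) :
    HahnSeries.single (-1 : ℤ) (1 : ℝ) • generatingSeries s =
      generatingSeries fun k => s (k + 1) := by
  ext1 i
  have h : generatingSeries s i =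
      HahnSeries.single (1 : ℤ) (1 : ℝ) * generatingSeries (fun k => s (k + 1)) i := by
    rw [← HahnSeries.ofPowerSeries_X, generatingSeries, generatingSeries, ← map_mul]
    congr 1
    ext k
    cases k with
    | zero => simp [h0]
    | succ k => simp [PowerSeries.coeff_succ_X_mul]
  rw [Pi.smul_apply, smul_eq_mul, h, ← mul_assoc, HahnSeries.single_mul_single]
  simp

theorem det_scalar_X_sub_ne_zero {n : ℕ} (A : Matrix (Fin n) (Fin n) ℝ) :
    (Matrix.scalar (Fin n) (RatFunc.X : RatFunc ℝ) -
      A.map (algebraMap ℝ (RatFunc ℝ))).det ≠ 0 := by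
  have h : Matrix.scalar (Fin n) (RatFunc.X : RatFunc ℝ) - A.map (algebraMap ℝ (RatFunc ℝ)) =
      A.charmatrix.map (algebraMap (Polynomial ℝ) (RatFunc ℝ)) := by
    ext i j
    by_cases hij : i = j <;> simp [hij]
  rw [h, ← RingHom.mapMatrix_apply, ← RingHom.map_det]
  exact RatFunc.algebraMap_ne_zero A.charpoly_monic.ne_zero

/-- On generating functions, the system started at rest acts as its transfer function. -/
theorem transferMatrix_mulVec_generatingSeries {n p m : ℕ} (A : Matrix (Fin n) (Fin n) ℝ)
    (B : Matrix (Fin n) (Fin p) ℝ) (C : Matrix (Fin m) (Fin n) ℝ) (D : Matrix (Fin m) (Fin p) ℝ)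
    (x : ℕ → Fin n → ℝ) (u : ℕ → Fin p → ℝ) (h0 : x 0 = 0)
    (hx : ∀ k, x (k + 1) = A.mulVec (x k) + B.mulVec (u k)) :
    ((transferMatrix A B C D).map expandAtInfinity).mulVec (generatingSeries u) =
      generatingSeries fun k => C.mulVec (x k) + D.mulVec (u k) := by
  have hmap {a b : ℕ} (M : Matrix (Fin a) (Fin b) ℝ) :
      (M.map (algebraMap ℝ (RatFunc ℝ))).map expandAtInfinity =
        M.map (algebraMap ℝ (LaurentSeries ℝ)) := by
    ext1 i j
    simp only [Matrix.map_apply, AlgHom.commutes]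
  set P := Matrix.scalar (Fin n) (RatFunc.X : RatFunc ℝ) - A.map (algebraMap ℝ (RatFunc ℝ))
    with hP
  have hPx : (P.map expandAtInfinity).mulVec (generatingSeries x) =
      (B.map (algebraMap ℝ (LaurentSeries ℝ))).mulVec (generatingSeries u) := by
    have hscalar : P.map expandAtInfinity =
        Matrix.scalar (Fin n) (HahnSeries.single (-1 : ℤ) (1 : ℝ)) -
          A.map (algebraMap ℝ (LaurentSeries ℝ)) := by
      rw [hP, Matrix.map_sub _ (map_sub _), hmap, ← expandAtInfinity_X]
      congr 1
      simp [Matrix.diagonal_map]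
    rw [hscalar, Matrix.sub_mulVec, Matrix.scalar_apply, ← Matrix.smul_one_eq_diagonal,
      Matrix.smul_mulVec, Matrix.one_mulVec, single_smul_generatingSeries x h0, funext hx,
      generatingSeries_add, generatingSeries_mulVec, generatingSeries_mulVec, add_sub_cancel_left]
  have hinv : P⁻¹.map expandAtInfinity * P.map expandAtInfinity = 1 := by
    rw [← Matrix.map_mul, Matrix.nonsing_inv_mul _ (det_scalar_X_sub_ne_zero A).isUnit,
      Matrix.map_one _ (map_zero _) (map_one _)]
  rw [transferMatrix, ← hP, Matrix.map_add _ (map_add _), Matrix.map_mul, Matrix.map_mul, hmap,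
    hmap, hmap, Matrix.add_mulVec, ← Matrix.mulVec_mulVec, ← Matrix.mulVec_mulVec, ← hPx,
    Matrix.mulVec_mulVec _ _ (P.map expandAtInfinity), hinv, Matrix.one_mulVec,
    generatingSeries_add, generatingSeries_mulVec, generatingSeries_mulVec]

open LaurentSeries in
/-- Up to a nonzero factor, every vector of Laurent series is a generating function. -/
theorem exists_smul_eq_generatingSeries {p : ℕ} (v : Fin p → ℝ⸨X⸩) :
    ∃ (c : ℝ⸨X⸩) (u : ℕ → Fin p → ℝ), c ≠ 0 ∧ c • v = generatingSeries u := by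
  obtain ⟨b, hb⟩ := IsLocalization.exist_integer_multiples_of_finite
    (nonZeroDivisors (PowerSeries ℝ)) v
  choose w hw using hb
  refine ⟨algebraMap _ _ (b : PowerSeries ℝ), fun k i => PowerSeries.coeff k (w i), ?_, ?_⟩
  · exact IsFractionRing.to_map_ne_zero_of_mem_nonZeroDivisors b.2
  · ext1 i
    rw [Pi.smul_apply, smul_eq_mul, ← Algebra.smul_def, ← hw i]
    exact congrArg _ (PowerSeries.ext fun k => by simp)

/-- The zero-initialised state trajectory driven by the input `u`. -/
def stateTrajectory {n p : ℕ} (A : Matrix (Fin n) (Fin n) ℝ) (B : Matrix (Fin n) (Fin p) ℝ)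
    (u : ℕ → Fin p → ℝ) : ℕ → Fin n → ℝ
  | 0 => 0
  | k + 1 => A.mulVec (stateTrajectory A B u k) + B.mulVec (u k)

/-- The system `(A, B, C, D)` is left invertible iff the transfer function
`C (zI - A)⁻¹ B + D` has full column rank `p` over `ℝ(z)` (normal rank `p`). -/
theorem leftInvertible_iff_normalRank_eq {n p m : ℕ}
    (A : Matrix (Fin n) (Fin n) ℝ) (B : Matrix (Fin n) (Fin p) ℝ)
    (C : Matrix (Fin m) (Fin n) ℝ) (D : Matrix (Fin m) (Fin p) ℝ) :
    LeftInvertible A B C D ↔ (transferMatrix A B C D).rank = p := by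
  rw [Matrix.rank_eq_width_iff_mulVec_injective]
  constructor
  · intro h
    refine (injective_iff_map_eq_zero (transferMatrix A B C D).mulVecLin).2 ?_
    intro v (hv : (transferMatrix A B C D).mulVec v = 0)
    obtain ⟨c, u, hc, hu⟩ := exists_smul_eq_generatingSeries (expandAtInfinity ∘ v)
    have hTv : ((transferMatrix A B C D).map expandAtInfinity).mulVec
        (expandAtInfinity ∘ v) = 0 := by
      ext1 i
      rw [← AlgHom.coe_toRingHom, ← RingHom.map_mulVec, hv]
      simp
    have key := transferMatrix_mulVec_generatingSeries A B C D (stateTrajectory A B u) u rfl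
      fun _ => rfl
    rw [← hu, Matrix.mulVec_smul, hTv, smul_zero, ← generatingSeries_zero] at key
    have hu0 := h (stateTrajectory A B u) u rfl (fun _ => rfl)
      fun k => (congrFun (generatingSeries_injective key) k).symm
    rw [funext hu0, generatingSeries_zero] at hu
    ext1 i
    exact (map_eq_zero expandAtInfinity).1 ((mul_eq_zero.1 (congrFun hu i)).resolve_left hc)
  · intro h x u h0 hx hy k
    have key := transferMatrix_mulVec_generatingSeries A B C D x u h0 hx
    rw [funext hy, generatingSeries_zero] at key
    have hu : generatingSeries u = 0 :=
      Matrix.mulVec_map_injective expandAtInfinity.toRingHom h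
        (key.trans (Matrix.mulVec_zero _).symm)
    rw [← generatingSeries_zero] at hu
    exact congrFun (generatingSeries_injective hu) k
end

section
/- Let A ∈ ℝ^{n×n}, C ∈ ℝ^{m×n}, K ∈ ℝ^{n×m}. Given any sequence Δy : ℕ → ℝ^m, define Δx̂ : ℕ → ℝ^n by Δx̂(0) = 0 and Δx̂(k+1) = (A − K C A) Δx̂(k) + K Δy(k+1), and define the residue difference Δz(k+1) = Δy(k+1) − C A Δx̂(k) for k ≥ 0. Then Δz(k) = 0 for all k ≥ 1 if and only if Δy(k) = 0 for all k ≥ 1. Consequently, there exists an attack producing a nonzero output difference with identically zero residue difference if and only if there exists one with identically zero output difference. -/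
/-- For the detection filter `Δx̂(k+1) = (A - KCA) Δx̂(k) + K Δy(k+1)` started at
`Δx̂(0) = 0`, with residue difference `Δz(k+1) = Δy(k+1) - CA Δx̂(k)`, the residue
difference vanishes for all `k ≥ 1` iff the output difference vanishes for all `k ≥ 1`. -/
theorem residue_zero_iff_output_zero {n m : ℕ}
    (A : Matrix (Fin n) (Fin n) ℝ) (C : Matrix (Fin m) (Fin n) ℝ)
    (K : Matrix (Fin n) (Fin m) ℝ)
    (dy : ℕ → Fin m → ℝ) (dxhat : ℕ → Fin n → ℝ) (dz : ℕ → Fin m → ℝ)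
    (h0 : dxhat 0 = 0)
    (hfilter : ∀ k, dxhat (k + 1) =
      (A - K * C * A).mulVec (dxhat k) + K.mulVec (dy (k + 1)))
    (hres : ∀ k, dz (k + 1) = dy (k + 1) - (C * A).mulVec (dxhat k)) :
    (∀ k, dz (k + 1) = 0) ↔ (∀ k, dy (k + 1) = 0) := by
  constructor
  · intro hz
    have hx : ∀ k, dxhat k = 0 := by
      intro k
      induction k with
      | zero => exact h0
      | succ k ih =>
        have hy : dy (k + 1) = 0 := by
          simpa [ih, hz k] using (hres k).symm
        simp [hfilter k, ih, hy]
    intro k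
    simpa [hx k, hz k] using (hres k).symm
  · intro hy
    have hx : ∀ k, dxhat k = 0 := by
      intro k
      induction k with
      | zero => exact h0
      | succ k ih => simp [hfilter k, ih, hy k]
    intro k
    simp [hres k, hx k, hy k]
end

section
/- Let A ∈ ℝ^{n×n}, B ∈ ℝ^{n×p}, C ∈ ℝ^{m×n}, D ∈ ℝ^{m×p}. Define the system digraph H on the vertex set U ∪ X ∪ Y, where U = {u_1,…,u_p}, X = {x_1,…,x_n}, Y = {y_1,…,y_m}, with an edge (u_j, x_i) whenever B_{ij} ≠ 0, an edge (x_j, x_i) whenever A_{ij} ≠ 0, an edge (x_j, y_i) whenever C_{ij} ≠ 0, and an edge (u_j, y_i) whenever D_{ij} ≠ 0. Then the rank over the field ℝ(z) of the matrix C (zI − A)^{-1} B + D is at most the maximum q such that H contains a q-linking from U to Y. -/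
/-- A walk from `a` to `b` along the edge relation `E`, recorded as its list of vertices. -/
def IsWalk {V : Type*} (E : V → V → Prop) (a b : V) (P : List V) : Prop :=
  P.Chain' E ∧ P.head? = some a ∧ P.getLast? = some b

/-- A `q`-linking from `A` to `B`: `q` pairwise vertex-disjoint simple paths,
each starting in `A` and ending in `B`. -/
def HasLinking {V : Type*} (E : V → V → Prop) (A B : Set V) (q : ℕ) : Prop :=
  ∃ P : Fin q → List V,
    (∀ i, (P i).Nodup ∧ ∃ a ∈ A, ∃ b ∈ B, IsWalk E a b (P i)) ∧
    ∀ i j, i ≠ j → ∀ v, v ∈ P i → v ∉ P j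

/-- The system digraph `H` on `U ∪ X ∪ Y`: inputs `u_j = Sum.inl j`, agents
`x_i = Sum.inr (Sum.inl i)` and outputs `y_i = Sum.inr (Sum.inr i)`, with edges
determined by the nonzero entries of `B`, `A`, `C`, `D` respectively. -/
def sysE {n p m : ℕ} (A : Matrix (Fin n) (Fin n) ℝ) (B : Matrix (Fin n) (Fin p) ℝ)
    (C : Matrix (Fin m) (Fin n) ℝ) (D : Matrix (Fin m) (Fin p) ℝ) :
    (Fin p ⊕ Fin n ⊕ Fin m) → (Fin p ⊕ Fin n ⊕ Fin m) → Prop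
  | Sum.inl j, Sum.inr (Sum.inl i) => B i j ≠ 0
  | Sum.inr (Sum.inl j), Sum.inr (Sum.inl i) => A i j ≠ 0
  | Sum.inr (Sum.inl j), Sum.inr (Sum.inr i) => C i j ≠ 0
  | Sum.inl j, Sum.inr (Sum.inr i) => D i j ≠ 0
  | _, _ => False

/-- A matrix over a field has as many linearly independent rows as its rank. -/
theorem Matrix.exists_linearIndependent_rows {K ι κ : Type*} [Field K] [Fintype ι] [Fintype κ]
    (M : Matrix ι κ K) :
    ∃ I : Fin M.rank → ι, LinearIndependent K (M.submatrix I id).row := by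
  rw [M.rank_eq_finrank_span_row]
  obtain ⟨f, hf, -, hli⟩ := Submodule.exists_fun_fin_finrank_span_eq K (Set.range M.row)
  choose I hI using hf
  obtain rfl : (M.submatrix I id).row = f := funext hI
  exact ⟨I, hli⟩

/-- A matrix over a field has a nonsingular square submatrix whose size is its rank. -/
theorem Matrix.exists_submatrix_det_ne_zero {K ι κ : Type*} [Field K] [Fintype ι] [Fintype κ]
    (M : Matrix ι κ K) :
    ∃ (I : Fin M.rank → ι) (J : Fin M.rank → κ), (M.submatrix I J).det ≠ 0 := by
  obtain ⟨I, hI⟩ := M.exists_linearIndependent_rows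
  have hrank : (M.submatrix I id).transpose.rank = M.rank := by
    rw [Matrix.rank_transpose, hI.rank_matrix, Fintype.card_fin]
  obtain ⟨J, hJ⟩ : ∃ J : Fin M.rank → κ,
      LinearIndependent K ((M.submatrix I id).transpose.submatrix J id).row := by
    have h := (M.submatrix I id).transpose.exists_linearIndependent_rows
    rwa [hrank] at h
  refine ⟨I, J, ?_⟩
  rw [← Matrix.det_transpose]
  exact ((Matrix.isUnit_iff_isUnit_det _).mp
    (Matrix.linearIndependent_rows_iff_isUnit.mp hJ)).ne_zero

/-- A permutation of `α ⊕ Fin r` that follows the edges of `E`, where `inl a` stands for the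
vertex `x a` while `inr k` stands for the source `s k` as an argument and for the target `t k` as
a value, traces out an `r`-linking from the sources to the targets. -/
theorem hasLinking_of_perm {α V : Type*} [Finite α] {r : ℕ} {E : V → V → Prop} {S T : Set V}
    (σ : Equiv.Perm (α ⊕ Fin r)) (s t : Fin r → V) (x : α → V)
    (hs : ∀ k, s k ∈ S) (ht : ∀ k, t k ∈ T) (hsi : Function.Injective s)
    (hxt : Function.Injective (Sum.elim x t)) (hne : ∀ k c, s k ≠ Sum.elim x t c)
    (hE : ∀ c, (∀ a, c = Sum.inl a → σ c ≠ c) → E (Sum.elim x s c) (Sum.elim x t (σ c))) :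
    HasLinking E S T r := by
  classical
  have hret : ∀ k : Fin r, ∃ n : ℕ, ((σ ^ (n + 1)) (Sum.inr k)).isRight := fun k =>
    ⟨orderOf σ - 1, by rw [Nat.sub_add_cancel (orderOf_pos σ), pow_orderOf_eq_one]; rfl⟩
  let N : Fin r → ℕ := fun k => Nat.find (hret k)
  have hN : ∀ k, ∃ l, (σ ^ (N k + 1)) (Sum.inr k) = Sum.inr l := fun k =>
    Sum.isRight_iff.mp (Nat.find_spec (hret k))
  have hmin : ∀ k d, d < N k → ∃ a, (σ ^ (d + 1)) (Sum.inr k) = Sum.inl a := fun k d hd => by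
    have := Nat.find_min (hret k) hd
    rwa [Sum.not_isRight, Sum.isLeft_iff] at this
  let v : Fin r → ℕ → V := fun k i =>
    Nat.casesOn i (s k) fun j => Sum.elim x t ((σ ^ (j + 1)) (Sum.inr k))
  have orbit : ∀ k k' i j, i ≤ j → j ≤ N k' →
      (σ ^ (i + 1)) (Sum.inr k) = (σ ^ (j + 1)) (Sum.inr k') → k = k' ∧ i = j := by
    intro k k' i j hij hj h
    obtain ⟨d, rfl⟩ := Nat.exists_eq_add_of_le hij
    rw [Nat.add_right_comm, pow_add _ (i + 1) d, Equiv.Perm.mul_apply] at h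
    have h' := (σ ^ (i + 1)).injective h
    cases d with
    | zero => exact ⟨by simpa using h', rfl⟩
    | succ d =>
      obtain ⟨a, ha⟩ := hmin k' d (by omega)
      rw [ha] at h'
      cases h'
  have inj : ∀ k k' i j, i ≤ N k + 1 → j ≤ N k' + 1 → v k i = v k' j → k = k' ∧ i = j := by
    intro k k' i j hi hj h
    cases i with
    | zero =>
      cases j with
      | zero => exact ⟨hsi h, rfl⟩
      | succ j => exact (hne _ _ h).elim
    | succ i =>
      cases j with
      | zero => exact (hne _ _ h.symm).elim
      | succ j =>
        have h' := hxt h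
        rcases le_total i j with hij | hij
        · obtain ⟨h1, h2⟩ := orbit k k' i j hij (by omega) h'
          exact ⟨h1, by rw [h2]⟩
        · obtain ⟨h1, h2⟩ := orbit k' k j i hij (by omega) h'.symm
          exact ⟨h1.symm, by rw [h2]⟩
  have step : ∀ k i, i ≤ N k → E (v k i) (v k (i + 1)) := by
    intro k i hi
    cases i with
    | zero => simpa [v] using hE (Sum.inr k) (by simp)
    | succ i =>
      obtain ⟨a, ha⟩ := hmin k i (by omega)
      have hfix : σ ((σ ^ (i + 1)) (Sum.inr k)) ≠ (σ ^ (i + 1)) (Sum.inr k) := by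
        rw [← Equiv.Perm.mul_apply, ← pow_succ']
        intro h
        have := (orbit k k i (i + 1) (by omega) hi h.symm).2
        omega
      have := hE _ fun _ _ => hfix
      rw [← Equiv.Perm.mul_apply, ← pow_succ', ha] at this
      simpa [v, ha] using this
  refine ⟨fun k => (List.range (N k + 2)).map (v k), fun k => ⟨?_, s k, hs k, ?_⟩, ?_⟩
  · refine List.Nodup.map_on (fun i hi j hj h => ?_) List.nodup_range
    rw [List.mem_range] at hi hj
    exact (inj k k i j (by omega) (by omega) h).2
  · obtain ⟨l, hl⟩ := hN k
    refine ⟨t l, ht l, ?_, ?_, ?_⟩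
    · refine (List.isChain_map _).mpr ((List.isChain_range_succ _ _).mpr fun i hi => ?_)
      exact step k i (by omega)
    · simp [List.range_succ_eq_map, v]
    · simp [List.range_succ, v, hl]
  · intro k k' hk w hw hw'
    obtain ⟨i, hi, rfl⟩ := List.mem_map.mp hw
    obtain ⟨j, hj, h⟩ := List.mem_map.mp hw'
    rw [List.mem_range] at hi hj
    exact hk (inj k k' i j (by omega) (by omega) h.symm).1

/-- A linking from a finite set has at most as many paths as the set has elements. -/
theorem HasLinking.le_ncard {V : Type*} {E : V → V → Prop} {S T : Set V} {q : ℕ}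
    (h : HasLinking E S T q) (hS : S.Finite) : q ≤ S.ncard := by
  obtain ⟨P, hP, hd⟩ := h
  choose a ha _ _ hw using fun i => (hP i).2
  have hmem : ∀ i, a i ∈ P i := fun i => List.mem_of_mem_head? (hw i).2.1
  have hinj : Function.Injective a := fun i j hij => by
    by_contra hne
    exact hd i j hne _ (hmem i) (hij ▸ hmem j)
  calc q = (Set.range a).ncard := by rw [Set.ncard_range_of_injective hinj]; simp
    _ ≤ S.ncard := Set.ncard_le_ncard (by rintro _ ⟨i, rfl⟩; exact ha i) hS

/-- The rank of `C (zI - A)⁻¹ B + D` over `ℝ(z)` is at most the maximum `q` such that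
the system digraph contains a `q`-linking from the inputs `U` to the outputs `Y`. -/
theorem rank_le_max_linking {n p m : ℕ}
    (A : Matrix (Fin n) (Fin n) ℝ) (B : Matrix (Fin n) (Fin p) ℝ)
    (C : Matrix (Fin m) (Fin n) ℝ) (D : Matrix (Fin m) (Fin p) ℝ) :
    (transferMatrix A B C D).rank ≤
      sSup {q : ℕ | HasLinking (sysE A B C D)
        {v | ∃ j : Fin p, v = Sum.inl j}
        {v | ∃ i : Fin m, v = Sum.inr (Sum.inr i)} q} := by
  obtain ⟨I, J, hdet⟩ := (transferMatrix A B C D).exists_submatrix_det_ne_zero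
  refine le_csSup ⟨_, fun q hq => HasLinking.le_ncard hq (Set.toFinite _)⟩ ?_
  have hI : Function.Injective I := fun k l hkl => by
    by_contra hne
    exact hdet (Matrix.det_zero_of_row_eq hne (by ext; simp [hkl]))
  have hJ : Function.Injective J := fun k l hkl => by
    by_contra hne
    exact hdet (Matrix.det_zero_of_column_eq hne (by simp [hkl]))
  let φ := algebraMap ℝ (RatFunc ℝ)
  let Z := Matrix.scalar (Fin n) (RatFunc.X : RatFunc ℝ) - A.map φ
  have hZ : IsUnit Z.det := (det_scalar_X_sub_ne_zero A).isUnit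
  let _ : Invertible Z := Z.invertibleOfIsUnitDet hZ
  let M := Matrix.fromBlocks Z (-(B.map φ).submatrix id J)
    ((C.map φ).submatrix I id) ((D.map φ).submatrix I J)
  have hM : M.det ≠ 0 := by
    rw [Matrix.det_fromBlocks₁₁, Matrix.invOf_eq_nonsing_inv]
    refine mul_ne_zero hZ.ne_zero ?_
    have h : (D.map φ).submatrix I J - (C.map φ).submatrix I id * Z⁻¹ *
        -(B.map φ).submatrix id J = (transferMatrix A B C D).submatrix I J := by
      rw [Matrix.mul_neg, sub_neg_eq_add, add_comm]
      rfl
    rwa [h]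
  obtain ⟨σ, hσ⟩ : ∃ σ : Equiv.Perm (Fin n ⊕ Fin _), ∀ c, M (σ c) c ≠ 0 := by
    by_contra! h
    refine hM ?_
    rw [Matrix.det_apply]
    refine Finset.sum_eq_zero fun σ _ => ?_
    obtain ⟨c, hc⟩ := h σ
    have hprod : ∏ i, M (σ i) i = 0 := Finset.prod_eq_zero (Finset.mem_univ c) hc
    exact (congrArg _ hprod).trans (smul_zero _)
  refine hasLinking_of_perm σ (fun k => Sum.inl (J k)) (fun k => Sum.inr (Sum.inr (I k)))
    (fun i => Sum.inr (Sum.inl i)) (fun k => ⟨_, rfl⟩) (fun k => ⟨_, rfl⟩) ?_ ?_ ?_ ?_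
  · exact Sum.inl_injective.comp hJ
  · rintro (a | a) (b | b) h <;> simp_all [hI.eq_iff]
  · rintro k (c | c) <;> simp
  · intro c hc
    have h := hσ c
    rcases c with j | k <;> rcases hr : σ _ with i | l <;> rw [hr] at h <;>
      simp only [Sum.elim_inl, Sum.elim_inr, sysE]
    · have hij : i ≠ j := fun e => hc j rfl (by rw [hr, e])
      simpa [M, Z, hij] using h
    · simpa [M] using h
    · simpa [M] using h
    · simpa [M] using h
end

section
/- In the DCS setting with 1 ≤ p ≤ m, the following are equivalent: (i) for every set F ⊆ X ∪ Y with 1 ≤ |F| ≤ p, the attacked graph G^a_F contains a |F|-linking from the input vertices to Y; (ii) for every agent x ∈ X, every vertex separator of (x, o) in the augmented graph G′ has cardinality at least p. -/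
/-- `S` is a vertex separator of the pair `(a, b)`: `a, b ∉ S` and every
path from `a` to `b` meets `S`. -/
def IsSeparator {V : Type*} (E : V → V → Prop) (a b : V) (S : Set V) : Prop :=
  a ∉ S ∧ b ∉ S ∧ ∀ P : List V, IsWalk E a b P → ∃ s ∈ S, s ∈ P

/-- `q` internally disjoint simple paths from `a` to `b`. -/
def HasInternallyDisjoint {V : Type*} (E : V → V → Prop) (a b : V) (q : ℕ) : Prop :=
  ∃ P : Fin q → List V,
    (∀ i, (P i).Nodup ∧ IsWalk E a b (P i)) ∧
    ∀ i j, i ≠ j → ∀ v, v ∈ P i → v ∈ P j → v = a ∨ v = b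

/-- A DCS digraph on `n` agents (`Sum.inl`) and `m` observers (`Sum.inr`):
every agent has a self-loop, each observer has exactly one incoming edge, which comes
from its (dedicated) agent `obs j`, distinct observers observe distinct agents, and
observers have no outgoing edges. -/
structure DCS (n m : ℕ) where
  E : (Fin n ⊕ Fin m) → (Fin n ⊕ Fin m) → Prop
  obs : Fin m → Fin n
  obs_inj : Function.Injective obs
  selfLoop : ∀ i : Fin n, E (Sum.inl i) (Sum.inl i)
  obs_in : ∀ (j : Fin m) (i : Fin n), E (Sum.inl i) (Sum.inr j) ↔ i = obs j
  obs_noOut : ∀ (j : Fin m) (v : Fin n ⊕ Fin m), ¬ E (Sum.inr j) v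

/-- Agent `x` is measured by some observer. -/
def Observed {n m : ℕ} (G : DCS n m) (x : Fin n) : Prop := ∃ j, G.obs j = x

/-- The augmented graph `G′`: a new vertex `o = Sum.inr ()` is added, with an
edge from every observer to `o`. -/
def augE {n m : ℕ} (G : DCS n m) :
    ((Fin n ⊕ Fin m) ⊕ Unit) → ((Fin n ⊕ Fin m) ⊕ Unit) → Prop
  | Sum.inl a, Sum.inl b => G.E a b
  | Sum.inl (Sum.inr _), Sum.inr _ => True
  | _, _ => False

/-- The collapsed graph `G″`: observers are deleted, a new vertex `o = Sum.inr ()`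
is added, and every observed agent gets an edge to `o`. -/
def colE {n m : ℕ} (G : DCS n m) :
    (Fin n ⊕ Unit) → (Fin n ⊕ Unit) → Prop
  | Sum.inl a, Sum.inl b => G.E (Sum.inl a) (Sum.inl b)
  | Sum.inl a, Sum.inr _ => ∃ j, G.obs j = a
  | _, _ => False

/-- The attacked graph `G^a_F`: one new (dedicated) input vertex for each element
of `F`, with a single edge from that input vertex to its element of `F`. -/
def atkE {V : Type*} (E : V → V → Prop) (F : Set V) :
    (V ⊕ ↥F) → (V ⊕ ↥F) → Prop
  | Sum.inl a, Sum.inl b => E a b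
  | Sum.inr u, Sum.inl b => (u : V) = b
  | _, _ => False

/-- The number of agent-to-agent edges (self-loops included), i.e. `‖A‖₀`. -/
noncomputable def agentEdgeCount {n m : ℕ} (G : DCS n m) : ℕ :=
  {e : Fin n × Fin n | G.E (Sum.inl e.1) (Sum.inl e.2)}.ncard

/-- Robustness to attacks on agents and sensors: every vertex separator of any
`(x, o)` in the augmented graph `G′` has cardinality at least `p`. -/
def RobustXY {n m : ℕ} (G : DCS n m) (p : ℕ) : Prop :=
  ∀ (x : Fin n) (S : Set ((Fin n ⊕ Fin m) ⊕ Unit)),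
    IsSeparator (augE G) (Sum.inl (Sum.inl x)) (Sum.inr ()) S → p ≤ S.ncard

/-- Robustness to agent-only attacks: for every unobserved agent `x`, every vertex
separator of `(x, o)` in the collapsed graph `G″` has cardinality at least `p`. -/
def RobustX {n m : ℕ} (G : DCS n m) (p : ℕ) : Prop :=
  ∀ x : Fin n, ¬ Observed G x → ∀ S : Set (Fin n ⊕ Unit),
    IsSeparator (colE G) (Sum.inl x) (Sum.inr ()) S → p ≤ S.ncard

theorem exists_walk_of_isChain_atkE {V : Type*} {E : V → V → Prop} {F : Set V}
    (M : List (V ⊕ ↥F)) (v : V) (h : (Sum.inl v :: M).IsChain (atkE E F)) :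
    ∃ L : List V, M = L.map Sum.inl ∧ (v :: L).IsChain E := by
  induction M generalizing v with
  | nil => exact ⟨[], rfl, by simp⟩
  | cons b M ih =>
    rw [List.isChain_cons_cons] at h
    obtain ⟨hb, hM⟩ := h
    cases b with
    | inr u => exact hb.elim
    | inl b =>
      obtain ⟨L, rfl, hL⟩ := ih b hM
      exact ⟨b :: L, rfl, List.isChain_cons_cons.2 ⟨hb, hL⟩⟩

/-- A walk in the attacked graph from an input to an original vertex consists of the input
followed by a walk in the original graph. -/
theorem IsWalk.exists_eq_cons_map {V : Type*} {E : V → V → Prop} {F : Set V} {u : ↥F} {y : V}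
    {P : List (V ⊕ ↥F)} (h : IsWalk (atkE E F) (Sum.inr u) (Sum.inl y) P) :
    ∃ L : List V, P = Sum.inr u :: (↑u :: L).map Sum.inl ∧ IsWalk E (u : V) y (↑u :: L) := by
  obtain ⟨hc, hh, hl⟩ := h
  match P, hc, hh, hl with
  | [a], _, hh, hl => simp at hh hl; simp [hh] at hl
  | a :: b :: M, hc, hh, hl =>
    simp only [List.head?_cons, Option.some.injEq] at hh
    subst hh
    have hc' := List.isChain_cons_cons.1 hc
    cases b with
    | inr w => exact hc'.1.elim
    | inl b =>
      have hb : (u : V) = b := hc'.1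
      subst hb
      obtain ⟨L, rfl, hL⟩ := exists_walk_of_isChain_atkE M _ hc'.2
      refine ⟨L, rfl, hL, rfl, ?_⟩
      rw [List.getLast?_cons_cons, ← List.map_cons, List.getLast?_map] at hl
      simpa using hl

/-- Prefixing a walk from an attacked vertex by its input gives a walk in the attacked graph. -/
theorem IsWalk.atkE_cons {V : Type*} {E : V → V → Prop} {F : Set V} {u : ↥F} {y : V}
    {L : List V} (h : IsWalk E (u : V) y L) :
    IsWalk (atkE E F) (Sum.inr u) (Sum.inl y) (Sum.inr u :: L.map Sum.inl) := by
  obtain ⟨hc, hh, hl⟩ := h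
  cases L with
  | nil => simp at hh
  | cons a L =>
    simp only [List.head?_cons, Option.some.injEq] at hh
    subst hh
    refine ⟨?_, rfl, ?_⟩
    · rw [List.map_cons]
      refine List.isChain_cons_cons.2 ⟨rfl, ?_⟩
      rw [← List.map_cons]
      exact (List.isChain_map _).2 hc
    · rw [List.map_cons, List.getLast?_cons_cons, ← List.map_cons, List.getLast?_map, hl]
      rfl

/-- The linking produced by attacking `insert x S` would make the path issuing from `x`
avoid the separator `S`. -/
theorem le_ncard_of_isSeparator_of_hasLinking {n m p : ℕ} {G : DCS n m}
    (hlink : ∀ F : Set (Fin n ⊕ Fin m), 1 ≤ F.ncard → F.ncard ≤ p →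
      HasLinking (atkE G.E F)
        {v : (Fin n ⊕ Fin m) ⊕ ↥F | ∃ u, v = Sum.inr u}
        {v : (Fin n ⊕ Fin m) ⊕ ↥F | ∃ j : Fin m, v = Sum.inl (Sum.inr j)} F.ncard)
    {x : Fin n} {S : Set ((Fin n ⊕ Fin m) ⊕ Unit)}
    (hS : IsSeparator (augE G) (Sum.inl (Sum.inl x)) (Sum.inr ()) S) : p ≤ S.ncard := by
  by_contra! hlt
  obtain ⟨hx, ho, hsep⟩ := hS
  set T : Set (Fin n ⊕ Fin m) := Sum.inl ⁻¹' S with hT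
  have hTS : Sum.inl '' T = S := by
    rw [hT, Set.image_preimage_eq_iff]
    rintro (v | v) hv
    · exact ⟨v, rfl⟩
    · exact (ho hv).elim
  have hTcard : T.ncard = S.ncard := by
    rw [← hTS, Set.ncard_image_of_injective _ Sum.inl_injective]
  have hF : (insert (Sum.inl x) T).ncard = S.ncard + 1 := by
    rw [Set.ncard_insert_of_notMem (show Sum.inl x ∉ T from hx) (Set.toFinite _), hTcard]
  obtain ⟨P, hP, hdis⟩ := hlink (insert (Sum.inl x) T) (by omega) (by omega)
  have hstart : ∀ i, ∃ u : ↥(insert (Sum.inl x) T : Set (Fin n ⊕ Fin m)), ∃ j, ∃ L : List _,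
      P i = Sum.inr u :: (↑u :: L).map Sum.inl ∧ IsWalk G.E ↑u (Sum.inr j) (↑u :: L) := by
    intro i
    obtain ⟨-, a, ⟨u, rfl⟩, b, ⟨j, rfl⟩, hw⟩ := hP i
    exact ⟨u, j, hw.exists_eq_cons_map⟩
  choose u j L hPL hw using hstart
  have hu : Function.Injective u := by
    intro i i' h
    by_contra hne
    exact hdis i i' hne (Sum.inr (u i)) (by simp [hPL]) (by simp [hPL, h])
  have hsurj : Function.Surjective u := by
    refine ((Nat.bijective_iff_injective_and_card u).2 ⟨hu, ?_⟩).2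
    rw [Nat.card_fin, Nat.card_coe_set_eq]
  obtain ⟨i₀, hi₀⟩ := hsurj ⟨Sum.inl x, Set.mem_insert _ _⟩
  obtain ⟨hc, -, hl⟩ := hw i₀
  have hux : (u i₀ : Fin n ⊕ Fin m) = Sum.inl x := by rw [hi₀]
  obtain ⟨s, hs, hsP⟩ := hsep ((↑(u i₀) :: L i₀).map Sum.inl ++ [Sum.inr ()]) (by
    refine ⟨?_, by simp [hux], List.getLast?_concat⟩
    refine List.isChain_append.2 ⟨(List.isChain_map _).2 hc, by simp, ?_⟩
    intro a ha b hb
    rw [List.getLast?_map, hl] at ha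
    simp at ha hb
    subst ha hb
    trivial)
  rw [← hTS] at hs
  obtain ⟨v, hv, rfl⟩ := hs
  have hvL : v ∈ (↑(u i₀) :: L i₀) := by simpa using hsP
  obtain ⟨i₁, hi₁⟩ := hsurj ⟨v, Set.mem_insert_of_mem _ hv⟩
  have hne : i₀ ≠ i₁ := by
    rintro rfl
    rw [hi₁] at hux
    exact hx (hux ▸ hv : Sum.inl x ∈ T)
  refine hdis i₀ i₁ hne (Sum.inl v) ?_ ?_
  · rw [hPL]
    exact List.mem_cons_of_mem _ (List.mem_map_of_mem hvL)
  · simp [hPL, hi₁]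

/-- The neighbourhood condition of Hall's theorem, for out-neighbourhoods avoiding `F`:
a violating set of agents is cut off from the observers by few vertices. -/
theorem exists_injective_successor {n m p : ℕ} {G : DCS n m}
    (hsep : ∀ (x : Fin n) (S : Set ((Fin n ⊕ Fin m) ⊕ Unit)),
      IsSeparator (augE G) (Sum.inl (Sum.inl x)) (Sum.inr ()) S → p ≤ S.ncard)
    {F : Set (Fin n ⊕ Fin m)} (hF : F.ncard ≤ p) :
    ∃ φ : Fin n → Fin n ⊕ Fin m, Function.Injective φ ∧
      ∀ i, G.E (Sum.inl i) (φ i) ∧ φ i ∉ F := by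
  classical
  set f : Finset (Fin n ⊕ Fin m) := F.toFinset with hf
  have hfc : f.card = F.ncard := (Set.ncard_eq_toFinset_card' F).symm
  let t : Fin n → Finset (Fin n ⊕ Fin m) := fun i => {v | G.E (Sum.inl i) v ∧ v ∉ f}
  have hall : ∀ W : Finset (Fin n), W.card ≤ (W.biUnion t).card := by
    intro W
    by_contra! hlt
    set w : Finset (Fin n ⊕ Fin m) := W.map Function.Embedding.inl with hw
    set N := W.biUnion t with hN
    have hwc : w.card = W.card := Finset.card_map _
    have hwN : w \ f ⊆ N := by
      intro v hv
      obtain ⟨hv, hvf⟩ := Finset.mem_sdiff.1 hv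
      obtain ⟨i, hi, rfl⟩ := Finset.mem_map.1 hv
      exact Finset.mem_biUnion.2 ⟨i, hi, by simpa [t] using ⟨G.selfLoop i, by simpa using hvf⟩⟩
    have h₁ : (N \ (w \ f)).card + (w \ f).card = N.card := Finset.card_sdiff_add_card_eq_card hwN
    have h₂ : (w \ f).card + (w ∩ f).card = w.card := Finset.card_sdiff_add_card_inter w f
    have h₃ : (f \ w).card + (f ∩ w).card = f.card := Finset.card_sdiff_add_card_inter f w
    rw [Finset.inter_comm] at h₃
    have h₄ := Finset.card_union_le (N \ (w \ f)) (f \ w)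
    obtain ⟨x', hx'⟩ : (w ∩ f).Nonempty := by
      rw [← Finset.card_pos]; omega
    obtain ⟨hxw, hxf⟩ := Finset.mem_inter.1 hx'
    obtain ⟨x, hx, rfl⟩ := Finset.mem_map.1 hxw
    set T := N \ (w \ f) ∪ f \ w with hT
    have hmem : ∀ v, v ∈ T ↔ (v ∈ N ∨ v ∈ f) ∧ v ∉ w := by
      intro v
      have hNf : v ∈ N → v ∉ f := by
        intro hv
        obtain ⟨i, -, hi⟩ := Finset.mem_biUnion.1 hv
        exact (Finset.mem_filter.1 hi).2.2
      simp only [hT, Finset.mem_union, Finset.mem_sdiff]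
      tauto
    have key : ∀ (P : List ((Fin n ⊕ Fin m) ⊕ Unit)) (i : Fin n), i ∈ W →
        IsWalk (augE G) (Sum.inl (Sum.inl i)) (Sum.inr ()) P →
        ∃ s ∈ (Sum.inl '' (T : Set (Fin n ⊕ Fin m)) : Set ((Fin n ⊕ Fin m) ⊕ Unit)), s ∈ P := by
      intro P
      induction P with
      | nil => rintro i - ⟨-, h, -⟩; simp at h
      | cons a P ih =>
        rintro i hi ⟨hc, hh, hl⟩
        simp only [List.head?_cons, Option.some.injEq] at hh
        subst hh
        cases P with
        | nil => simp at hl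
        | cons b P =>
          have hc' := List.isChain_cons_cons.1 hc
          rw [List.getLast?_cons_cons] at hl
          cases b with
          | inr o => exact hc'.1.elim
          | inl b =>
            have hE : G.E (Sum.inl i) b := hc'.1
            by_cases hb : b ∈ w
            · obtain ⟨k, hk, rfl⟩ := Finset.mem_map.1 hb
              obtain ⟨s, hs, hsP⟩ := ih k hk ⟨hc'.2, rfl, hl⟩
              exact ⟨s, hs, List.mem_cons_of_mem _ hsP⟩
            · refine ⟨Sum.inl b, ⟨b, ?_, rfl⟩, by simp⟩
              refine Finset.mem_coe.2 ((hmem b).2 ⟨?_, hb⟩)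
              by_cases hbf : b ∈ f
              · exact Or.inr hbf
              · exact Or.inl (Finset.mem_biUnion.2
                  ⟨i, hi, Finset.mem_filter.2 ⟨Finset.mem_univ _, hE, hbf⟩⟩)
    have := hsep x (Sum.inl '' (T : Set (Fin n ⊕ Fin m))) ⟨?_, ?_, fun P => key P x hx⟩
    · rw [Set.ncard_image_of_injective _ Sum.inl_injective, Set.ncard_coe_finset] at this
      omega
    · rintro ⟨v, hv, h⟩
      cases h
      exact ((hmem _).1 hv).2 hxw
    · rintro ⟨v, hv, h⟩
      cases h
  obtain ⟨φ, hinj, hφ⟩ := (Finset.all_card_le_biUnion_card_iff_exists_injective t).1 hall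
  refine ⟨φ, hinj, fun i => ?_⟩
  have := Finset.mem_filter.1 (hφ i)
  exact ⟨this.2.1, by simpa [hf] using this.2.2⟩

section SuccessorOrbits

variable {α β : Type*} {φ : α → α ⊕ β}

/-- One step along the partial successor map `φ`. -/
def SuccStep (φ : α → α ⊕ β) (a b : α ⊕ β) : Prop := ∃ i, a = Sum.inl i ∧ b = φ i

theorem eq_or_exists_mem_tail_of_isChain {f : α ⊕ β} (L : List (α ⊕ β))
    (hc : L.IsChain (flip (SuccStep φ))) (hl : L.getLast? = some f) {v : α ⊕ β} (hv : v ∈ L) :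
    v = f ∨ ∃ i, v = φ i ∧ Sum.inl i ∈ L.tail := by
  induction L with
  | nil => simp at hv
  | cons a L ih =>
    cases L with
    | nil => left; simp_all
    | cons b L =>
      rw [List.getLast?_cons_cons] at hl
      obtain ⟨⟨i, hb, ha⟩, hc⟩ := List.isChain_cons_cons.1 hc
      rcases List.mem_cons.1 hv with rfl | hv
      · exact Or.inr ⟨i, ha, by simp [hb]⟩
      · rcases ih hc hl hv with h | ⟨k, hk, hk'⟩
        · exact Or.inl h
        · exact Or.inr ⟨k, hk, List.mem_cons_of_mem _ hk'⟩

/-- Following an injective successor map from a point outside its range, one leaves its domain. -/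
theorem exists_nodup_walk_succStep [Finite α] [Finite β] (hφ : Function.Injective φ)
    {f : α ⊕ β} (hf : ∀ i, φ i ≠ f) :
    ∃ L : List (α ⊕ β), L.Nodup ∧ ∃ j, IsWalk (SuccStep φ) f (Sum.inr j) L := by
  by_contra! hno
  have hlong : ∀ k : ℕ, ∃ L : List (α ⊕ β), L.length = k + 1 ∧ L.Nodup ∧
      L.IsChain (flip (SuccStep φ)) ∧ L.getLast? = some f := by
    intro k
    induction k with
    | zero => exact ⟨[f], by simp⟩
    | succ k ih =>
      obtain ⟨L, hlen, hnd, hc, hl⟩ := ih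
      cases L with
      | nil => simp at hl
      | cons a L =>
        cases a with
        | inr j =>
          refine (hno (Sum.inr j :: L).reverse (List.nodup_reverse.2 hnd) j ⟨?_, ?_, ?_⟩).elim
          · exact List.isChain_reverse.2 hc
          · rw [List.head?_reverse, hl]
          · rw [List.getLast?_reverse, List.head?_cons]
        | inl i =>
          refine ⟨φ i :: Sum.inl i :: L, by simp_all, List.nodup_cons.2 ⟨fun hmem => ?_, hnd⟩,
            List.isChain_cons_cons.2 ⟨⟨i, rfl, rfl⟩, hc⟩, by rw [List.getLast?_cons_cons, hl]⟩
          rcases eq_or_exists_mem_tail_of_isChain _ hc hl hmem with h | ⟨k, hk, hk'⟩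
          · exact hf i h
          · rw [hφ hk] at hnd
            exact (List.nodup_cons.1 hnd).1 hk'
  have := Fintype.ofFinite (α ⊕ β)
  obtain ⟨L, hlen, hnd, -⟩ := hlong (Fintype.card (α ⊕ β))
  have := hnd.length_le_card
  omega

theorem reflTransGen_of_mem_walk {V : Type*} {E : V → V → Prop} {a b v : V} {L : List V}
    (h : IsWalk E a b L) (hv : v ∈ L) : Relation.ReflTransGen E a v := by
  obtain ⟨hc, hh, -⟩ := h
  induction L generalizing a with
  | nil => simp at hv
  | cons c L ih =>
    simp only [List.head?_cons, Option.some.injEq] at hh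
    subst hh
    rcases List.mem_cons.1 hv with rfl | hv
    · exact .refl
    · cases L with
      | nil => simp at hv
      | cons d L =>
        obtain ⟨h, hc⟩ := List.isChain_cons_cons.1 hc
        exact (ih hv hc rfl).head h

theorem eq_of_reflTransGen_succStep (hφ : Function.Injective φ) {f g v : α ⊕ β}
    (hf : ∀ i, φ i ≠ f) (hg : ∀ i, φ i ≠ g)
    (h : Relation.ReflTransGen (SuccStep φ) f v) (h' : Relation.ReflTransGen (SuccStep φ) g v) :
    f = g := by
  induction h with
  | refl =>
    rcases h'.cases_tail with h | ⟨c, -, i, -, hi⟩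
    · exact h
    · exact (hf i hi.symm).elim
  | tail _ hs ih =>
    obtain ⟨i, rfl, rfl⟩ := hs
    rcases h'.cases_tail with h | ⟨c, hc, k, rfl, hk⟩
    · exact (hg i h).elim
    · rw [← hφ hk] at hc
      exact ih hc

end SuccessorOrbits

theorem hasLinking_of_injective_successor {n m : ℕ} {G : DCS n m} {F : Set (Fin n ⊕ Fin m)}
    {φ : Fin n → Fin n ⊕ Fin m} (hφ : Function.Injective φ)
    (hE : ∀ i, G.E (Sum.inl i) (φ i) ∧ φ i ∉ F) :
    HasLinking (atkE G.E F)
      {v : (Fin n ⊕ Fin m) ⊕ ↥F | ∃ u, v = Sum.inr u}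
      {v : (Fin n ⊕ Fin m) ⊕ ↥F | ∃ j : Fin m, v = Sum.inl (Sum.inr j)} F.ncard := by
  have hF : ∀ (u : ↥F) (i : Fin n), φ i ≠ u := fun u i h => (hE i).2 (h ▸ u.2)
  choose L hnd j hw using fun u : ↥F => exists_nodup_walk_succStep hφ (hF u)
  have hwE : ∀ u : ↥F, IsWalk G.E (u : Fin n ⊕ Fin m) (Sum.inr (j u)) (L u) := fun u =>
    ⟨(hw u).1.imp (by rintro a b ⟨i, rfl, rfl⟩; exact (hE i).1), (hw u).2⟩
  let e : Fin F.ncard ≃ ↥F := (Finite.equivFinOfCardEq (Nat.card_coe_set_eq F)).symm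
  refine ⟨fun i => Sum.inr (e i) :: (L (e i)).map Sum.inl, fun i => ⟨?_, ?_⟩, ?_⟩
  · refine List.nodup_cons.2 ⟨by simp, (hnd (e i)).map Sum.inl_injective⟩
  · exact ⟨_, ⟨e i, rfl⟩, _, ⟨j (e i), rfl⟩, (hwE (e i)).atkE_cons⟩
  · rintro i k hne (v | u) hv hv'
    · have hi : v ∈ L (e i) := by simpa using hv
      have hk : v ∈ L (e k) := by simpa using hv'
      exact hne (e.injective (Subtype.ext (eq_of_reflTransGen_succStep hφ (hF _) (hF _)
        (reflTransGen_of_mem_walk (hw _) hi) (reflTransGen_of_mem_walk (hw _) hk))))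
    · have hi : u = e i := by simpa using hv
      have hk : u = e k := by simpa using hv'
      exact hne (e.injective (hi.symm.trans hk))

/-- Vertex-separator characterization of structural left invertibility for all feasible
attacks on agents and sensors: for `1 ≤ p ≤ m ≤ n`, every feasible attack set
`F ⊆ X ∪ Y` with `1 ≤ |F| ≤ p` admits an `|F|`-linking from the inputs to `Y` in the
attacked graph iff every vertex separator of any `(x, o)` in the augmented graph `G′`
has cardinality at least `p`. -/
theorem structural_left_invertibility_iff_separators {n m p : ℕ}
    (hp : 1 ≤ p) (hpm : p ≤ m) (hmn : m ≤ n) (G : DCS n m) :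
    (∀ F : Set (Fin n ⊕ Fin m), 1 ≤ F.ncard → F.ncard ≤ p →
      HasLinking (atkE G.E F)
        {v : (Fin n ⊕ Fin m) ⊕ ↥F | ∃ u, v = Sum.inr u}
        {v : (Fin n ⊕ Fin m) ⊕ ↥F | ∃ j : Fin m, v = Sum.inl (Sum.inr j)}
        F.ncard) ↔
    (∀ (x : Fin n) (S : Set ((Fin n ⊕ Fin m) ⊕ Unit)),
      IsSeparator (augE G) (Sum.inl (Sum.inl x)) (Sum.inr ()) S → p ≤ S.ncard) := by
  refine ⟨fun h x S hS => le_ncard_of_isSeparator_of_hasLinking h hS, fun h F _ hF => ?_⟩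
  obtain ⟨φ, hφ, hE⟩ := exists_injective_successor h hF
  exact hasLinking_of_injective_successor hφ hE
end

section
/- In the DCS setting with 1 ≤ p ≤ m, suppose some agent x₁ ∈ X admits a vertex separator S of (x₁, o) in the augmented graph G′ with |S| = l ≤ p − 1, and set F = {x₁} ∪ S (so F ⊆ X ∪ Y and |F| = l + 1 ≤ p). Then the attacked graph G^a_F contains no (l+1)-linking from its input vertices to Y. -/
theorem atkE_isChain_eq_map {V : Type*} {E : V → V → Prop} {F : Set V} (L : List (V ⊕ ↥F)) :
    ∀ a : V, List.IsChain (atkE E F) (Sum.inl a :: L) →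
      ∃ Q : List V, L = Q.map Sum.inl ∧ List.IsChain E (a :: Q) := by
  induction L with
  | nil => exact fun a _ => ⟨[], rfl, .singleton a⟩
  | cons b L ih =>
    intro a h
    rw [List.isChain_cons_cons] at h
    obtain ⟨hab, h⟩ := h
    cases b with
    | inl b =>
      obtain ⟨Q, rfl, hQ⟩ := ih b h
      exact ⟨b :: Q, rfl, List.isChain_cons_cons.2 ⟨hab, hQ⟩⟩
    | inr b => exact hab.elim

/-- A walk of the attacked graph from an input vertex to an original vertex is the input edge
followed by a walk of the original graph. -/
theorem IsWalk.eq_cons_map_of_atkE {V : Type*} {E : V → V → Prop} {F : Set V} {u : ↥F} {b : V}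
    {P : List (V ⊕ ↥F)} (h : IsWalk (atkE E F) (Sum.inr u) (Sum.inl b) P) :
    ∃ Q : List V, P = Sum.inr u :: ((u : V) :: Q).map Sum.inl ∧ IsWalk E u b (u :: Q) := by
  obtain ⟨hc, hh, hl⟩ := h
  match P, hh with
  | [_], rfl => simp at hl
  | _ :: Sum.inr c :: L, rfl => exact (List.isChain_cons_cons.1 hc).1.elim
  | _ :: Sum.inl c :: L, rfl =>
    obtain ⟨huc, hc⟩ := List.isChain_cons_cons.1 hc
    obtain rfl : (u : V) = c := huc
    obtain ⟨Q, rfl, hQ⟩ := atkE_isChain_eq_map L _ hc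
    refine ⟨Q, rfl, hQ, rfl, ?_⟩
    rw [List.getLast?_cons_cons, ← List.map_cons, List.getLast?_map,
      Option.map_eq_some_iff] at hl
    obtain ⟨c, hc, hcb⟩ := hl
    rw [hc, Sum.inl_injective hcb]

/-- A walk of a DCS digraph that ends in an observer extends to the new vertex of the augmented
graph. -/
theorem IsWalk.augE_append {n m : ℕ} {G : DCS n m} {a : Fin n ⊕ Fin m} {j : Fin m}
    {Q : List (Fin n ⊕ Fin m)} (h : IsWalk G.E a (Sum.inr j) Q) :
    IsWalk (augE G) (Sum.inl a) (Sum.inr ()) (Q.map Sum.inl ++ [Sum.inr ()]) := by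
  obtain ⟨hc, hh, hl⟩ := h
  refine ⟨List.isChain_append.2 ⟨(List.isChain_map _).2 hc, .singleton _, ?_⟩, ?_, ?_⟩
  · simp [hl, augE]
  · simp [hh]
  · simp

/-- If some agent `x₁` admits a vertex separator `S` of `(x₁, o)` in the augmented
graph `G′` with `|S| + 1 ≤ p` (i.e. `|S| = l ≤ p - 1`), then for the feasible attack
set `F = {x₁} ∪ S` (of cardinality `l + 1 ≤ p`) the attacked graph `G^a_F` contains
no `(l+1)`-linking from its input vertices to `Y`. -/
theorem separator_gives_no_linking {n m p : ℕ}
    (hp : 1 ≤ p) (hpm : p ≤ m) (hmn : m ≤ n) (G : DCS n m)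
    (x₁ : Fin n) (S : Set (Fin n ⊕ Fin m))
    (hsep : IsSeparator (augE G) (Sum.inl (Sum.inl x₁)) (Sum.inr ())
      (Sum.inl '' S : Set ((Fin n ⊕ Fin m) ⊕ Unit)))
    (hcard : S.ncard + 1 ≤ p) :
    ¬ HasLinking (atkE G.E (insert (Sum.inl x₁) S))
      {v : (Fin n ⊕ Fin m) ⊕ ↥(insert (Sum.inl x₁) S : Set (Fin n ⊕ Fin m)) |
        ∃ u, v = Sum.inr u}
      {v : (Fin n ⊕ Fin m) ⊕ ↥(insert (Sum.inl x₁) S : Set (Fin n ⊕ Fin m)) |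
        ∃ j : Fin m, v = Sum.inl (Sum.inr j)}
      (S.ncard + 1) := by
  rintro ⟨P, hP, hdisj⟩
  have hpath : ∀ i, ∃ (u : ↥(insert (Sum.inl x₁) S : Set (Fin n ⊕ Fin m))) (j : Fin m)
      (Q : List (Fin n ⊕ Fin m)), P i = Sum.inr u :: ((u : Fin n ⊕ Fin m) :: Q).map Sum.inl ∧
        IsWalk G.E u (Sum.inr j) (u :: Q) := by
    intro i
    obtain ⟨-, _, ⟨u, rfl⟩, _, ⟨j, rfl⟩, hw⟩ := hP i
    obtain ⟨Q, hQ⟩ := hw.eq_cons_map_of_atkE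
    exact ⟨u, j, Q, hQ⟩
  choose u j Q hPQ hw using hpath
  have hinj : Function.Injective u := by
    intro i k hik
    by_contra hne
    exact hdisj i k hne (Sum.inr (u i)) (by simp [hPQ i]) (by simp [hPQ k, hik])
  have hx₁ : (Sum.inl x₁ : Fin n ⊕ Fin m) ∉ S := fun h => hsep.1 ⟨_, h, rfl⟩
  have hsurj : Function.Surjective u := by
    refine (hinj.bijective_of_nat_card_le ?_).2
    rw [Nat.card_coe_set_eq, Set.ncard_insert_of_notMem hx₁ S.toFinite, Nat.card_fin]
  obtain ⟨i, hi⟩ := hsurj ⟨Sum.inl x₁, Set.mem_insert _ _⟩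
  have hwi := hw i
  rw [hi] at hwi
  obtain ⟨_, ⟨s, hs, rfl⟩, hmem⟩ := hsep.2.2 _ hwi.augE_append
  obtain ⟨k, hk⟩ := hsurj ⟨s, Set.mem_insert_of_mem _ hs⟩
  have hik : i ≠ k := by
    rintro rfl
    have hxs : Sum.inl x₁ = s := congrArg Subtype.val (hi.symm.trans hk)
    exact hx₁ (hxs ▸ hs)
  refine hdisj i k hik (Sum.inl s) ?_ ?_
  · rw [hPQ i, hi]
    simpa using hmem
  · simp [hPQ k, hk]
end

section
/- Fix integers n ≥ m ≥ p ≥ 1. Over all DCS digraphs G on n agents and m observers (every agent with a self-loop, dedicated sensors) that satisfy the robustness condition — for every agent x ∈ X, every vertex separator of (x, o) in the augmented graph G′ has cardinality at least p — the minimum possible number of edges among agents (edges in X × X, self-loops included) equals np + n − m. -/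
open Classical in
/-- The agent-to-agent edges are counted by summing the out-degrees. -/
theorem agentEdgeCount_eq_sum {n m : ℕ} (G : DCS n m) :
    agentEdgeCount G =
      ∑ i : Fin n, (Finset.univ.filter fun k : Fin n => G.E (Sum.inl i) (Sum.inl k)).card := by
  have h : {e : Fin n × Fin n | G.E (Sum.inl e.1) (Sum.inl e.2)} =
      ((Finset.univ.filter fun e : Fin n × Fin n => G.E (Sum.inl e.1) (Sum.inl e.2) :
        Finset (Fin n × Fin n)) : Set (Fin n × Fin n)) := by
    ext e; simp
  rw [agentEdgeCount, h, Set.ncard_coe_finset]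
  simp only [Finset.card_filter, Fintype.sum_prod_type]

open Classical in
/-- Exactly `n - m` agents are unobserved. -/
theorem sum_add_unobserved {n m : ℕ} (G : DCS n m) (p : ℕ) (hmn : m ≤ n) :
    ∑ i : Fin n, (p + if Observed G i then 0 else 1) = n * p + n - m := by
  have hcard : (Finset.univ.filter fun i : Fin n => Observed G i).card = m := by
    have h : (Finset.univ.filter fun i : Fin n => Observed G i) = Finset.univ.image G.obs := by
      ext i
      rw [Finset.mem_filter]
      simp [Observed]
    rw [h, Finset.card_image_of_injective _ G.obs_inj, Finset.card_univ, Fintype.card_fin]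
  have hsum := Finset.card_filter_add_card_filter_not
    (s := (Finset.univ : Finset (Fin n))) (Observed G)
  rw [hcard, Finset.card_univ, Fintype.card_fin] at hsum
  have hite : ∑ i : Fin n, (if Observed G i then 0 else 1) =
      (Finset.univ.filter fun i : Fin n => ¬ Observed G i).card := by
    rw [Finset.card_filter]
    exact Finset.sum_congr rfl fun i _ => by split_ifs <;> simp_all
  rw [Finset.sum_add_distrib, hite]
  simp only [Finset.sum_const, Finset.card_univ, Fintype.card_fin, smul_eq_mul]
  omega

/-- The out-neighbours of an agent, other than itself, separate it from `o`. -/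
theorem isSeparator_outNeighbours {n m : ℕ} (G : DCS n m) (x : Fin n) :
    IsSeparator (augE G) (Sum.inl (Sum.inl x)) (Sum.inr ())
      {v | v ≠ Sum.inl (Sum.inl x) ∧ augE G (Sum.inl (Sum.inl x)) v} := by
  refine ⟨by simp, by simp [augE], ?_⟩
  rintro P ⟨hc, hh, hl⟩
  induction P with
  | nil => simp at hh
  | cons a l ih =>
    simp only [List.head?_cons, Option.some.injEq] at hh
    subst hh
    cases l with
    | nil => simp at hl
    | cons b l =>
      have hc' := List.isChain_cons_cons.1 hc
      by_cases hb : b = Sum.inl (Sum.inl x)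
      · subst hb
        obtain ⟨s, hs, hs'⟩ := ih hc'.2 rfl (by simpa using hl)
        exact ⟨s, hs, List.mem_cons_of_mem _ hs'⟩
      · exact ⟨b, ⟨hb, hc'.1⟩, by simp⟩

open Classical in
/-- Robustness bounds the out-degree of every agent from below. -/
theorem RobustXY.le_outDegree {n m p : ℕ} {G : DCS n m} (hG : RobustXY G p) (x : Fin n) :
    (p + if Observed G x then 0 else 1) ≤
      (Finset.univ.filter fun k : Fin n => G.E (Sum.inl x) (Sum.inl k)).card := by
  set D := Finset.univ.filter fun k : Fin n => G.E (Sum.inl x) (Sum.inl k) with hD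
  have hx : x ∈ D := by simp [hD, G.selfLoop]
  set O := Finset.univ.filter fun j : Fin m => x = G.obs j with hO
  have hset : {v | v ≠ Sum.inl (Sum.inl x) ∧ augE G (Sum.inl (Sum.inl x)) v} =
      ((((D.erase x).disjSum O).disjSum (∅ : Finset Unit) :
        Finset ((Fin n ⊕ Fin m) ⊕ Unit)) : Set ((Fin n ⊕ Fin m) ⊕ Unit)) := by
    ext v
    rcases v with (k | j) | u
    · simp [hD, augE]
    · simp [hO, augE, G.obs_in]
    · simp [augE]
  have h := hG x _ (isSeparator_outNeighbours G x)
  rw [hset, Set.ncard_coe_finset, Finset.card_disjSum, Finset.card_disjSum,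
    Finset.card_empty, Finset.card_erase_of_mem hx] at h
  have hpos : 0 < D.card := Finset.card_pos.2 ⟨x, hx⟩
  have hOle : O.card ≤ if Observed G x then 1 else 0 := by
    split_ifs with ho
    · refine Finset.card_le_one.2 fun a ha b hb => G.obs_inj ?_
      simp only [hO, Finset.mem_filter, Finset.mem_univ, true_and] at ha hb
      rw [← ha, ← hb]
    · simp only [Nat.le_zero, Finset.card_eq_zero, hO, Finset.filter_eq_empty_iff]
      exact fun j _ hj => ho ⟨j, hj.symm⟩
  split_ifs at hOle ⊢ <;> omega

/-- If every agent has edges to `p` observed agents (itself allowed), the system is robust. -/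
theorem robustXY_of_edges_to_observed {n m p : ℕ} (G : DCS n m)
    (h : ∀ x : Fin n, ∃ t : Fin p → Fin m, Function.Injective t ∧
      ∀ k, G.E (Sum.inl x) (Sum.inl (G.obs (t k)))) : RobustXY G p := by
  rintro x S ⟨hx, ho, hS⟩
  obtain ⟨t, ht, hE⟩ := h x
  have key : ∀ k, ∃ s ∈ S, s = Sum.inl (Sum.inl (G.obs (t k))) ∨
      s = Sum.inl (Sum.inr (t k)) := by
    intro k
    obtain ⟨s, hs, hmem⟩ := hS [Sum.inl (Sum.inl x), Sum.inl (Sum.inl (G.obs (t k))),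
      Sum.inl (Sum.inr (t k)), Sum.inr ()]
      ⟨by
        refine List.isChain_cons_cons.2 ⟨hE k, List.isChain_cons_cons.2
          ⟨(G.obs_in _ _).2 rfl, List.isChain_cons_cons.2 ⟨trivial, List.isChain_singleton _⟩⟩⟩,
        rfl, rfl⟩
    simp only [List.mem_cons, List.not_mem_nil, or_false] at hmem
    rcases hmem with rfl | h | h | rfl
    · exact absurd hs hx
    · exact ⟨s, hs, Or.inl h⟩
    · exact ⟨s, hs, Or.inr h⟩
    · exact absurd hs ho
  choose f hfS hf using key
  have hinj : Function.Injective f := by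
    intro a b hab
    apply ht
    rcases hf a with ha | ha <;> rcases hf b with hb | hb <;> rw [ha, hb] at hab <;>
      simp only [Sum.inl.injEq, Sum.inr.injEq, reduceCtorEq] at hab
    · exact G.obs_inj hab
    · exact hab
  calc p = (Set.range f).ncard := by
        rw [← Set.image_univ, Set.ncard_image_of_injective _ hinj, Set.ncard_univ]; simp
    _ ≤ S.ncard := Set.ncard_le_ncard (by rintro _ ⟨k, rfl⟩; exact hfS k) (Set.toFinite S)

/-- The number of initial agents to which agent `i` is linked in `extremalDCS`. -/
def linkCount (m p i : ℕ) : ℕ := if p ≤ i ∧ i < m then p - 1 else p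

/-- A sparsest robust system: the first `m` agents are observed, and agent `i` has a
self-loop together with edges to the first `linkCount m p i` agents. -/
def extremalDCS (n m p : ℕ) (hmn : m ≤ n) : DCS n m where
  E
    | Sum.inl i, Sum.inl k => k = i ∨ k.val < linkCount m p i
    | Sum.inl i, Sum.inr j => i = Fin.castLE hmn j
    | Sum.inr _, _ => False
  obs := Fin.castLE hmn
  obs_inj := Fin.castLE_injective hmn
  selfLoop _ := Or.inl rfl
  obs_in _ _ := Iff.rfl
  obs_noOut _ _ := id

theorem observed_extremalDCS {n m p : ℕ} (hmn : m ≤ n) (i : Fin n) :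
    Observed (extremalDCS n m p hmn) i ↔ i.val < m :=
  ⟨by rintro ⟨j, rfl⟩; exact j.isLt, fun h => ⟨⟨i, h⟩, rfl⟩⟩

theorem robustXY_extremalDCS {n m p : ℕ} (hpm : p ≤ m) (hmn : m ≤ n) :
    RobustXY (extremalDCS n m p hmn) p := by
  refine robustXY_of_edges_to_observed _ fun x => ?_
  by_cases hx : p ≤ x.val ∧ x.val < m
  · refine ⟨fun k => if k.val < p - 1 then Fin.castLE hpm k else ⟨x, hx.2⟩, ?_, ?_⟩
    · intro a b hab
      have := congrArg Fin.val hab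
      ext
      dsimp only at this
      split_ifs at this <;> simp at this <;> omega
    · intro k
      by_cases hk : k.val < p - 1
      · right
        simp [linkCount, hx, hk, extremalDCS]
      · left
        ext
        simp [hk, extremalDCS]
  · exact ⟨Fin.castLE hpm, Fin.castLE_injective hpm, fun k => Or.inr (by
      simp [linkCount, hx, extremalDCS])⟩

open Classical in
theorem outDegree_extremalDCS {n m p : ℕ} (hp : 1 ≤ p) (hpm : p ≤ m) (hmn : m ≤ n) (i : Fin n) :
    (Finset.univ.filter fun k : Fin n =>
      (extremalDCS n m p hmn).E (Sum.inl i) (Sum.inl k)).card =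
      p + if Observed (extremalDCS n m p hmn) i then 0 else 1 := by
  have hset : (Finset.univ.filter fun k : Fin n =>
      (extremalDCS n m p hmn).E (Sum.inl i) (Sum.inl k)) =
      insert i (Finset.univ.filter fun k : Fin n => k.val < linkCount m p i) := by
    ext k
    rw [Finset.mem_filter]
    simp [extremalDCS]
  have hcard : (Finset.univ.filter fun k : Fin n => k.val < linkCount m p i).card =
      linkCount m p i := by
    rw [Fin.card_filter_val_lt]
    unfold linkCount
    split_ifs <;> omega
  rw [hset, Finset.card_insert_eq_ite, hcard]
  simp only [observed_extremalDCS, Finset.mem_filter, Finset.mem_univ, true_and]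
  unfold linkCount
  split_ifs <;> omega

/-- Over all DCS digraphs on `n` agents and `m` observers that are robust to all
feasible attacks on agents and sensors of size at most `p` (every vertex separator of
any `(x, o)` in `G′` has cardinality at least `p`), the minimum possible number of
agent-to-agent edges (self-loops included) equals `np + n - m`. -/
theorem min_edges_robustXY {n m p : ℕ} (hp : 1 ≤ p) (hpm : p ≤ m) (hmn : m ≤ n) :
    IsLeast {k : ℕ | ∃ G : DCS n m, RobustXY G p ∧ agentEdgeCount G = k}
      (n * p + n - m) := by
  constructor
  · refine ⟨extremalDCS n m p hmn, robustXY_extremalDCS hpm hmn, ?_⟩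
    rw [agentEdgeCount_eq_sum, ← sum_add_unobserved (extremalDCS n m p hmn) p hmn]
    exact Finset.sum_congr rfl fun i _ => outDegree_extremalDCS hp hpm hmn i
  · rintro k ⟨G, hG, rfl⟩
    rw [agentEdgeCount_eq_sum, ← sum_add_unobserved G p hmn]
    exact Finset.sum_le_sum fun i _ => hG.le_outDegree i
end

section
/- Fix integers n ≥ m ≥ p ≥ 1. Every DCS digraph G on n agents and m observers (every agent with a self-loop, dedicated sensors) satisfying the robustness condition — for every agent x ∈ X, every vertex separator of (x, o) in the augmented graph G′ has cardinality at least p — has at least np + n − m = mp + (n − m)(p + 1) edges among agents (edges in X × X, self-loops included). -/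
theorem IsWalk.exists_mem_out_ne {V : Type*} {E : V → V → Prop} {a b : V} (hab : a ≠ b) :
    ∀ {P : List V}, IsWalk E a b P → ∃ s ∈ P, E a s ∧ s ≠ a
  | [], h => by simp [IsWalk] at h
  | [v], h => by
    obtain ⟨-, h₁, h₂⟩ := h
    simp only [List.head?_cons, List.getLast?_singleton, Option.some.injEq] at h₁ h₂
    exact absurd (h₁.symm.trans h₂) hab
  | v :: w :: P, h => by
    obtain ⟨hc, h₁, h₂⟩ := h
    obtain rfl : v = a := by simpa using h₁
    obtain ⟨hvw, hwP⟩ := List.isChain_cons_cons.mp hc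
    by_cases hw : w = v
    · subst hw
      obtain ⟨s, hs, hws⟩ := IsWalk.exists_mem_out_ne (P := w :: P) hab
        ⟨hwP, rfl, by simpa [List.getLast?_cons_cons] using h₂⟩
      exact ⟨s, List.mem_cons_of_mem _ hs, hws⟩
    · exact ⟨w, by simp, hvw, hw⟩

/-- The out-neighbours of `a` other than `a` itself separate `a` from any non-neighbour. -/
theorem isSeparator_out_ne {V : Type*} {E : V → V → Prop} {a b : V} (hab : a ≠ b)
    (hE : ¬ E a b) : IsSeparator E a b {s | E a s ∧ s ≠ a} :=
  ⟨fun h => h.2 rfl, fun h => hE h.1, fun _ hP =>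
    let ⟨s, hs, h⟩ := hP.exists_mem_out_ne hab
    ⟨s, h, hs⟩⟩

open Classical in
theorem RobustXY.lt_card_out {n m p : ℕ} {G : DCS n m} (hrob : RobustXY G p) (x : Fin n) :
    p < (Finset.univ.filter fun v => G.E (Sum.inl x) v).card := by
  have h := hrob x _ (isSeparator_out_ne (E := augE G) (a := Sum.inl (Sum.inl x))
    (b := Sum.inr ()) (by simp) (by simp [augE]))
  set N := Finset.univ.filter fun v => G.E (Sum.inl x) v with hN
  have hS : {s | augE G (Sum.inl (Sum.inl x)) s ∧ s ≠ Sum.inl (Sum.inl x)} =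
      ((N.erase (Sum.inl x)).map Function.Embedding.inl : Finset ((Fin n ⊕ Fin m) ⊕ Unit)) := by
    ext (v | v)
    · simp [augE, hN, and_comm]
    · simp [augE]
  rw [hS, Set.ncard_coe_finset, Finset.card_map] at h
  exact h.trans_lt (Finset.card_erase_lt_of_mem (by simpa [hN] using G.selfLoop x))

open Classical in
theorem sum_card_out {n m : ℕ} (G : DCS n m) :
    ∑ x, (Finset.univ.filter fun v => G.E (Sum.inl x) v).card = agentEdgeCount G + m := by
  have hm : ∑ x, (Finset.univ.filter fun j => G.obs j = x).card = m := by
    rw [← Finset.card_eq_sum_card_fiberwise (by simp)]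
    simp
  have hA : agentEdgeCount G =
      ∑ x, (Finset.univ.filter fun i => G.E (Sum.inl x) (Sum.inl i)).card := by
    rw [agentEdgeCount, Set.ncard_eq_toFinset_card', Set.toFinset_ofPred]
    simp only [Finset.card_filter]
    exact Fintype.sum_prod_type _
  rw [hA, ← congrArg (_ + ·) hm, ← Finset.sum_add_distrib]
  refine Finset.sum_congr rfl fun x _ => ?_
  simp only [Finset.card_filter, Fintype.sum_sum_type, G.obs_in, eq_comm]

/-- Every DCS digraph on `n` agents and `m` observers that is robust to all feasible
attacks on agents and sensors of size at most `p` has at least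
`np + n - m = mp + (n - m)(p + 1)` agent-to-agent edges (self-loops included). -/
theorem edges_lower_bound_robustXY {n m p : ℕ} (hp : 1 ≤ p) (hpm : p ≤ m) (hmn : m ≤ n)
    (G : DCS n m) (hrob : RobustXY G p) :
    n * p + n - m = m * p + (n - m) * (p + 1) ∧
    n * p + n - m ≤ agentEdgeCount G := by
  have hle : n ≤ n * p := Nat.le_mul_of_pos_right n hp
  refine ⟨?_, ?_⟩
  · obtain ⟨k, rfl⟩ := Nat.exists_eq_add_of_le hmn
    rw [Nat.add_sub_cancel_left, Nat.sub_eq_iff_eq_add (by omega)]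
    ring
  · have h := Finset.sum_le_sum fun x (_ : x ∈ Finset.univ) =>
      Nat.succ_le_of_lt (hrob.lt_card_out x)
    rw [sum_card_out] at h
    simp only [Finset.sum_const, Finset.card_univ, Fintype.card_fin, smul_eq_mul,
      Nat.succ_eq_add_one, mul_add, mul_one] at h
    omega
end

section
/- Fix integers n ≥ m ≥ p ≥ 1. There exists a DCS digraph G on n agents and m observers (every agent with a self-loop, dedicated sensors) with exactly np + n − m edges among agents (edges in X × X, self-loops included) satisfying: for every agent x ∈ X, every vertex separator of (x, o) in the augmented graph G′ has cardinality at least p. Such a G is obtained by observing agents x_1,…,x_m and letting each observed agent have, besides its self-loop and the edge to its observer, edges to p − 1 other observed agents, and letting each unobserved agent have, besides its self-loop, edges to p observed agents. -/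
/-- The DCS digraph observing the first `m` agents, in which the out-neighbours of agent `x`
among agents are the elements of `T x`. -/
def DCS.ofOutNeighbors {n m : ℕ} (hmn : m ≤ n) (T : Fin n → Finset (Fin n))
    (hT : ∀ x, x ∈ T x) : DCS n m where
  E
    | Sum.inl a, Sum.inl b => b ∈ T a
    | Sum.inl a, Sum.inr j => a = Fin.castLE hmn j
    | Sum.inr _, _ => False
  obs := Fin.castLE hmn
  obs_inj := Fin.castLE_injective hmn
  selfLoop := hT
  obs_in _ _ := Iff.rfl
  obs_noOut _ _ := id

theorem agentEdgeCount_ofOutNeighbors {n m : ℕ} (hmn : m ≤ n) (T : Fin n → Finset (Fin n))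
    (hT : ∀ x, x ∈ T x) :
    agentEdgeCount (DCS.ofOutNeighbors hmn T hT) = ∑ x, (T x).card := by
  have h : {e : Fin n × Fin n | (DCS.ofOutNeighbors hmn T hT).E (Sum.inl e.1) (Sum.inl e.2)} =
      ((Finset.univ.sigma T).map (Equiv.sigmaEquivProd (Fin n) (Fin n)).toEmbedding :
        Finset (Fin n × Fin n)) := by
    ext ⟨a, b⟩
    simp [DCS.ofOutNeighbors]
  rw [agentEdgeCount, h, Set.ncard_coe_finset, Finset.card_map, Finset.card_sigma]

/-- A vertex separator of `(x, o)` in the augmented graph has at least as many elements as `x`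
has observed out-neighbours. -/
theorem IsSeparator.card_observed_le {n m : ℕ} {G : DCS n m} {x : Fin n}
    {S : Set ((Fin n ⊕ Fin m) ⊕ Unit)}
    (hS : IsSeparator (augE G) (Sum.inl (Sum.inl x)) (Sum.inr ()) S) {J : Finset (Fin m)}
    (hJ : ∀ j ∈ J, G.E (Sum.inl x) (Sum.inl (G.obs j))) : J.card ≤ S.ncard := by
  classical
  obtain ⟨hx, ho, hsep⟩ := hS
  have hmeet : ∀ j ∈ J, Sum.inl (Sum.inl (G.obs j)) ∈ S ∨ Sum.inl (Sum.inr j) ∈ S := by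
    intro j hj
    have hobs : G.E (Sum.inl (G.obs j)) (Sum.inr j) := (G.obs_in j _).2 rfl
    obtain ⟨s, hs, hmem⟩ := hsep
      [Sum.inl (Sum.inl x), Sum.inl (Sum.inl (G.obs j)), Sum.inl (Sum.inr j), Sum.inr ()]
      ⟨by change List.IsChain _ _; simp [augE, hJ j hj, hobs], rfl, rfl⟩
    simp only [List.mem_cons, List.not_mem_nil, or_false] at hmem
    rcases hmem with rfl | rfl | rfl | rfl
    · exact absurd hs hx
    · exact Or.inl hs
    · exact Or.inr hs
    · exact absurd hs ho
  let f : Fin m → (Fin n ⊕ Fin m) ⊕ Unit := fun j =>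
    if Sum.inl (Sum.inl (G.obs j)) ∈ S then Sum.inl (Sum.inl (G.obs j)) else Sum.inl (Sum.inr j)
  have hf : Function.Injective f := by
    intro i j hij
    simp only [f] at hij
    split_ifs at hij
    · exact G.obs_inj (Sum.inl_injective (Sum.inl_injective hij))
    · simp at hij
    · simp at hij
    · exact Sum.inr_injective (Sum.inl_injective hij)
  rw [← Set.ncard_coe_finset, ← Set.ncard_image_of_injective _ hf]
  refine Set.ncard_le_ncard ?_ (Set.toFinite S)
  rintro _ ⟨j, hj, rfl⟩
  simp only [f]
  split_ifs with h
  · exact h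
  · exact (hmeet j hj).resolve_left h

/-- There exists a DCS digraph on `n` agents and `m` observers with exactly
`np + n - m` agent-to-agent edges (self-loops included) that is robust to all feasible
attacks on agents and sensors of size at most `p`. It observes agents `x₁, …, x_m`;
each observed agent has, among agents, exactly `p` out-edges (its self-loop and edges
to `p - 1` other observed agents), and each unobserved agent has exactly `p + 1`
out-edges among agents (its self-loop and edges to `p` observed agents). -/
theorem exists_minimal_robustXY {n m p : ℕ} (hp : 1 ≤ p) (hpm : p ≤ m) (hmn : m ≤ n) :
    ∃ G : DCS n m,
      agentEdgeCount G = n * p + n - m ∧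
      (∀ j : Fin m, (G.obs j : ℕ) = (j : ℕ)) ∧
      (∀ x : Fin n, Observed G x →
        {b : Fin n | G.E (Sum.inl x) (Sum.inl b)}.ncard = p ∧
        ∀ b : Fin n, G.E (Sum.inl x) (Sum.inl b) → Observed G b) ∧
      (∀ x : Fin n, ¬ Observed G x →
        {b : Fin n | G.E (Sum.inl x) (Sum.inl b)}.ncard = p + 1 ∧
        ∀ b : Fin n, G.E (Sum.inl x) (Sum.inl b) → b ≠ x → Observed G b) ∧
      RobustXY G p := by
  classical
  let O : Finset (Fin n) := Finset.univ.map (Fin.castLEEmb hmn)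
  have hO : O.card = m := by simp [O]
  have hex : ∀ x : Fin n, ∃ T : Finset (Fin n),
      x ∈ T ∧ T ⊆ insert x O ∧ T.card = if x ∈ O then p else p + 1 := by
    intro x
    obtain ⟨T, h₁, h₂, h₃⟩ := Finset.exists_subsuperset_card_eq
      (s := {x}) (t := insert x O) (n := if x ∈ O then p else p + 1) (by simp)
      (by rw [Finset.card_singleton]; split_ifs <;> omega)
      (by split_ifs with h <;> simp [h, hO, hpm])
    exact ⟨T, by simpa using h₁, h₂, h₃⟩
  choose T hxT hTO hcard using hex
  have hobs : ∀ x, Observed (DCS.ofOutNeighbors hmn T hxT) x ↔ x ∈ O := by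
    intro x
    simp [Observed, DCS.ofOutNeighbors, O]
  have hncard : ∀ x, {b | (DCS.ofOutNeighbors hmn T hxT).E (Sum.inl x) (Sum.inl b)}.ncard =
      (T x).card := fun x => Set.ncard_coe_finset (T x)
  refine ⟨DCS.ofOutNeighbors hmn T hxT, ?_, fun _ => rfl, ?_, ?_, ?_⟩
  · have hsplit : ∀ x, (T x).card + (if x ∈ O then 1 else 0) = p + 1 := by
      intro x
      rw [hcard]
      split_ifs <;> rfl
    have hsum := Finset.sum_congr (rfl : (Finset.univ : Finset (Fin n)) = Finset.univ)
      fun x _ => hsplit x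
    simp only [Finset.sum_add_distrib, Finset.sum_boole, Finset.filter_univ_mem, hO,
      Finset.sum_const, Finset.card_univ, Fintype.card_fin, smul_eq_mul, Nat.cast_id,
      mul_one] at hsum
    rw [agentEdgeCount_ofOutNeighbors]
    omega
  · intro x hx
    rw [hobs] at hx
    refine ⟨by rw [hncard, hcard, if_pos hx], fun b hb => (hobs b).2 ?_⟩
    simpa [hx] using hTO x hb
  · intro x hx
    rw [hobs] at hx
    refine ⟨by rw [hncard, hcard, if_neg hx], fun b hb hbx => (hobs b).2 ?_⟩
    simpa [hbx] using hTO x hb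
  · intro x S hS
    let J : Finset (Fin m) := Finset.univ.filter fun j => Fin.castLE hmn j ∈ T x
    refine le_trans ?_ (hS.card_observed_le (J := J) fun j hj => (Finset.mem_filter.1 hj).2)
    have hJ : J.map (Fin.castLEEmb hmn) = T x ∩ O := by
      ext b
      simp only [J, O, Finset.mem_map, Finset.mem_filter, Finset.mem_univ, true_and,
        Finset.mem_inter, Fin.castLEEmb_apply]
      constructor
      · rintro ⟨j, hj, rfl⟩
        exact ⟨hj, j, rfl⟩
      · rintro ⟨hb, j, rfl⟩
        exact ⟨j, hb, rfl⟩
    rw [← Finset.card_map (Fin.castLEEmb hmn), hJ]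
    by_cases hx : x ∈ O
    · have hsub : T x ⊆ O := by simpa [hx] using hTO x
      rw [Finset.inter_eq_left.2 hsub, hcard, if_pos hx]
    · have hsub : (T x).erase x ⊆ T x ∩ O := Finset.subset_inter (Finset.erase_subset _ _)
        (Finset.subset_insert_iff.1 (hTO x))
      have hle := Finset.card_le_card hsub
      rwa [Finset.card_erase_of_mem (hxT x), hcard, if_neg hx, Nat.add_sub_cancel] at hle
end

section
/- Fix integers n ≥ m ≥ p ≥ 1. Let G be the DCS digraph on n agents and m observers in which agents x_{n−m+1},…,x_n are observed by dedicated sensors, each observed agent has only its self-loop (and the edge to its observer), and each unobserved agent has its self-loop plus edges to p distinct observed agents. Then G has exactly (n − m)p + n edges among agents (edges in X × X, self-loops included), and for every unobserved agent x ∈ X, every vertex separator of (x, o) in the collapsed graph G″ has cardinality at least p. -/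
theorem ncard_setOf_rel_eq_sum {α β : Type*} [Fintype α] [Fintype β] (R : α → β → Prop) :
    {e : α × β | R e.1 e.2}.ncard = ∑ a, {b | R a b}.ncard := by
  classical
  simp only [Set.ncard_eq_toFinset_card', Set.toFinset_ofPred, Finset.card_filter,
    Fintype.sum_prod_type]

/-- Dedicated sensors observe exactly `m` agents. -/
theorem ncard_setOf_observed {n m : ℕ} (G : DCS n m) : {x | Observed G x}.ncard = m := by
  have h : {x | Observed G x} = Set.range G.obs := rfl
  rw [h, ← Set.image_univ, Set.ncard_image_of_injective _ G.obs_inj, Set.ncard_univ,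
    Nat.card_fin]

/-- Every separator of `(x, o)` in `G″` contains each observed out-neighbour of `x`. -/
theorem mem_separator_of_observed_neighbour {n m : ℕ} {G : DCS n m} {x b : Fin n}
    {S : Set (Fin n ⊕ Unit)} (hS : IsSeparator (colE G) (Sum.inl x) (Sum.inr ()) S)
    (hxb : G.E (Sum.inl x) (Sum.inl b)) (hb : Observed G b) : Sum.inl b ∈ S := by
  obtain ⟨hx, ho, hsep⟩ := hS
  have hxb' : colE G (Sum.inl x) (Sum.inl b) := hxb
  have hb' : colE G (Sum.inl b) (Sum.inr ()) := hb
  obtain ⟨s, hs, hsP⟩ := hsep [Sum.inl x, Sum.inl b, Sum.inr ()]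
    ⟨.cons_cons hxb' (.cons_cons hb' (.singleton _)), rfl, rfl⟩
  simp only [List.mem_cons, List.not_mem_nil, or_false] at hsP
  rcases hsP with rfl | rfl | rfl
  · exact absurd hs hx
  · exact hs
  · exact absurd hs ho

/-- The minimal agent-only design: agents `x_{n-m+1}, …, x_n` (0-indexed: indices
`n - m, …, n - 1`) are observed, each observed agent has only its self-loop among
agents, and each unobserved agent has its self-loop plus edges to `p` distinct observed
agents. Such a `G` has exactly `(n - m)p + n` agent-to-agent edges and satisfies the
agents-only robustness condition. -/
theorem minimal_agentsOnly_design {n m p : ℕ} (hp : 1 ≤ p) (hpm : p ≤ m) (hmn : m ≤ n)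
    (G : DCS n m)
    (hobs : ∀ j : Fin m, (G.obs j : ℕ) = n - m + (j : ℕ))
    (hobsE : ∀ x : Fin n, Observed G x → ∀ b : Fin n,
      G.E (Sum.inl x) (Sum.inl b) ↔ b = x)
    (hunE : ∀ x : Fin n, ¬ Observed G x →
      {b : Fin n | G.E (Sum.inl x) (Sum.inl b) ∧ b ≠ x}.ncard = p ∧
      ∀ b : Fin n, G.E (Sum.inl x) (Sum.inl b) → b ≠ x → Observed G b) :
    agentEdgeCount G = (n - m) * p + n ∧ RobustX G p := by
  classical
  constructor
  · have hdeg : ∀ x : Fin n, {b : Fin n | G.E (Sum.inl x) (Sum.inl b)}.ncard =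
        (if ¬ Observed G x then p else 0) + 1 := by
      intro x
      by_cases hx : Observed G x
      · simp [hobsE x hx, hx]
      · have hins : {b : Fin n | G.E (Sum.inl x) (Sum.inl b)} =
            insert x {b : Fin n | G.E (Sum.inl x) (Sum.inl b) ∧ b ≠ x} := by
          ext b
          by_cases hb : b = x
          · simp [hb, G.selfLoop x]
          · simp [hb]
        rw [hins, Set.ncard_insert_of_notMem (by simp), (hunE x hx).1, if_pos hx]
    have hun : (Finset.univ.filter fun x => ¬ Observed G x).card = n - m := by
      have hm := ncard_setOf_observed G
      rw [Set.ncard_eq_toFinset_card', Set.toFinset_ofPred] at hm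
      have hadd := Finset.card_filter_add_card_filter_not (s := Finset.univ) (Observed G)
      rw [hm, Finset.card_univ, Fintype.card_fin] at hadd
      omega
    rw [agentEdgeCount,
      ncard_setOf_rel_eq_sum (fun a b : Fin n => G.E (Sum.inl a) (Sum.inl b))]
    simp only [hdeg]
    rw [Finset.sum_add_distrib, ← Finset.sum_filter, Finset.sum_const, hun]
    simp
  · intro x hx S hS
    obtain ⟨hcard, hnb⟩ := hunE x hx
    rw [← hcard, ← Set.ncard_image_of_injective _ (Sum.inl_injective (β := Unit))]
    refine Set.ncard_le_ncard ?_ S.toFinite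
    rintro _ ⟨b, ⟨hxb, hbx⟩, rfl⟩
    exact mem_separator_of_observed_neighbour hS hxb (hnb b hxb hbx)
end

section
/- Fix integers n ≥ m ≥ p ≥ 1. Let G be the platooning DCS digraph on agents x_1,…,x_n in which agents x_{n−m+1},…,x_n are observed by dedicated sensors, the agent-to-agent edge set is E^f = {(x_i, x_{i+k}) : 1 ≤ i ≤ n − m, 0 ≤ k ≤ p} ∪ {(x_i, x_i) : n − m + 1 ≤ i ≤ n}, and let G″ be its collapsed graph. Then for every unobserved agent x_i (1 ≤ i ≤ n − m): (a) the set {x_{i+1},…,x_{i+p}} is a vertex separator of (x_i, o) in G″ of cardinality p, and (b) every vertex separator of (x_i, o) in G″ has cardinality at least p (so {x_{i+1},…,x_{i+p}} is a minimum vertex separator). -/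
theorem IsWalk.cons {V : Type*} {E : V → V → Prop} {a b c : V} {P : List V}
    (hab : E a b) (hP : IsWalk E b c P) : IsWalk E a c (a :: P) := by
  obtain ⟨hchain, hhead, hlast⟩ := hP
  cases P with
  | nil => simp at hhead
  | cons d P =>
    obtain rfl : d = b := by simpa using hhead
    exact ⟨List.isChain_cons_cons.2 ⟨hab, hchain⟩, rfl, by simpa using hlast⟩

/-- An invariant set `A` that can only be left through `S` confines the walks that avoid `S`. -/
theorem IsWalk.exists_mem_of_exits {V : Type*} {E : V → V → Prop} {A S : Set V} {b : V}
    (hA : ∀ u ∈ A, ∀ v, E u v → v ∈ A ∨ v ∈ S) (hb : b ∉ A) :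
    ∀ {P : List V} {a : V}, a ∈ A → IsWalk E a b P → ∃ s ∈ S, s ∈ P := by
  intro P
  induction P with
  | nil => rintro a - ⟨-, h, -⟩; simp at h
  | cons c P ih =>
    rintro a ha ⟨hchain, hhead, hlast⟩
    obtain rfl : c = a := by simpa using hhead
    cases P with
    | nil =>
      obtain rfl : c = b := by simpa using hlast
      exact absurd ha hb
    | cons d P =>
      obtain ⟨hcd, hP⟩ := List.isChain_cons_cons.1 hchain
      rcases hA c ha d hcd with hd | hd
      · obtain ⟨s, hs, hsP⟩ := ih hd ⟨hP, rfl, by simpa using hlast⟩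
        exact ⟨s, hs, List.mem_cons_of_mem _ hsP⟩
      · exact ⟨d, hd, by simp⟩

theorem ncard_inl_image_window {n p i : ℕ} (h : i + p < n) :
    (Sum.inl '' {j : Fin n | i < (j : ℕ) ∧ (j : ℕ) ≤ i + p} : Set (Fin n ⊕ Unit)).ncard = p := by
  rw [Set.ncard_image_of_injective _ Sum.inl_injective,
    ← Set.ncard_image_of_injective _ Fin.val_injective]
  have : (Fin.val '' {j : Fin n | i < (j : ℕ) ∧ (j : ℕ) ≤ i + p}) =
      (Finset.Ioc i (i + p) : Set ℕ) := by
    ext x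
    simp only [Set.mem_image, Set.mem_ofPred_eq, Finset.coe_Ioc, Set.mem_Ioc]
    constructor
    · rintro ⟨j, hj, rfl⟩
      exact hj
    · intro hx
      exact ⟨⟨x, by omega⟩, hx, rfl⟩
  rw [this, Set.ncard_coe_finset]
  simp

/-- The platooning DCS digraph: agents `x_{n-m+1}, …, x_n` (0-indexed: `n - m, …, n - 1`)
are observed, and the agent-to-agent edges are exactly
`{(x_i, x_{i+k}) : i < n - m, 0 ≤ k ≤ p}` together with the self-loops of the observed
agents. For every unobserved agent `x_i`: (a) `{x_{i+1}, …, x_{i+p}}` is a vertex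
separator of `(x_i, o)` in the collapsed graph `G″` of cardinality `p`, and (b) every
vertex separator of `(x_i, o)` in `G″` has cardinality at least `p`. -/
theorem platooning_minimum_separators {n m p : ℕ} (hp : 1 ≤ p) (hpm : p ≤ m)
    (hmn : m ≤ n) (G : DCS n m)
    (hobs : ∀ j : Fin m, (G.obs j : ℕ) = n - m + (j : ℕ))
    (hE : ∀ a b : Fin n, G.E (Sum.inl a) (Sum.inl b) ↔
      (((a : ℕ) < n - m ∧ ∃ k ≤ p, (b : ℕ) = (a : ℕ) + k) ∨
        (n - m ≤ (a : ℕ) ∧ b = a))) :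
    ∀ i : Fin n, (i : ℕ) < n - m →
      (IsSeparator (colE G) (Sum.inl i) (Sum.inr ())
          (Sum.inl '' {j : Fin n | (i : ℕ) < (j : ℕ) ∧ (j : ℕ) ≤ (i : ℕ) + p}) ∧
        (Sum.inl '' {j : Fin n | (i : ℕ) < (j : ℕ) ∧ (j : ℕ) ≤ (i : ℕ) + p} :
          Set (Fin n ⊕ Unit)).ncard = p) ∧
      (∀ S : Set (Fin n ⊕ Unit),
        IsSeparator (colE G) (Sum.inl i) (Sum.inr ()) S → p ≤ S.ncard) := by
  intro i hi
  refine ⟨⟨⟨by simp, by simp, fun P hP => ?_⟩, ncard_inl_image_window (by omega)⟩, ?_⟩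
  · refine hP.exists_mem_of_exits (A := Sum.inl '' {a : Fin n | (a : ℕ) ≤ i}) ?_ (by simp)
      ⟨i, by simp, rfl⟩
    rintro _ ⟨a, ha, rfl⟩ (b | _) hab
    · simp only [Set.mem_ofPred_eq] at ha
      simp only [Sum.inl_injective.mem_set_image, Set.mem_ofPred_eq]
      rcases (hE a b).1 hab with ⟨-, k, hk, hb⟩ | ⟨hle, -⟩ <;> omega
    · obtain ⟨j, rfl⟩ := hab
      have := hobs j
      simp only [Set.mem_ofPred_eq] at ha
      omega
  · rintro S ⟨hiS, hoS, hS⟩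
    by_contra! hcard
    have escape : ∀ d : ℕ, ∀ a : Fin n, n - (a : ℕ) = d → Sum.inl a ∉ S →
        ∃ P, IsWalk (colE G) (Sum.inl a) (Sum.inr ()) P ∧ ∀ s ∈ S, s ∉ P := by
      intro d
      induction d using Nat.strong_induction_on with
      | _ d ih =>
        intro a had ha
        have havoid : ∀ P, (∀ s ∈ S, s ∉ P) → ∀ s ∈ S, s ∉ Sum.inl a :: P := by
          intro P hP s hs hmem
          rcases List.mem_cons.1 hmem with rfl | h
          exacts [ha hs, hP s hs h]
        by_cases hobserved : (a : ℕ) < n - m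
        · obtain ⟨_, ⟨b, ⟨hab, hbp⟩, rfl⟩, hbS⟩ := Set.exists_mem_notMem_of_ncard_lt_ncard
            (hcard.trans_eq (ncard_inl_image_window (n := n) (i := a) (p := p) (by omega)).symm)
          obtain ⟨P, hP, hPS⟩ := ih _ (by omega) b rfl hbS
          have hstep : colE G (Sum.inl a) (Sum.inl b) :=
            (hE a b).2 (Or.inl ⟨hobserved, b - a, by omega, by omega⟩)
          exact ⟨_, hP.cons hstep, havoid P hPS⟩
        · have hstep : colE G (Sum.inl a) (Sum.inr ()) :=
            ⟨⟨a - (n - m), by omega⟩, Fin.ext (by rw [hobs]; simp only; omega)⟩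
          have hend : IsWalk (colE G) (Sum.inr ()) (Sum.inr ()) [Sum.inr ()] :=
            ⟨List.isChain_singleton _, rfl, rfl⟩
          refine ⟨_, hend.cons hstep, havoid _ fun s hs hmem => hoS ?_⟩
          rwa [List.mem_singleton.1 hmem] at hs
    obtain ⟨P, hP, hPS⟩ := escape _ i rfl hiS
    obtain ⟨s, hs, hsP⟩ := hS P hP
    exact hPS s hs hsP
end

section
/- Fix integers n ≥ m ≥ p ≥ 1. Consider all DCS digraphs G on n agents and m observers (every agent with a self-loop, dedicated sensors, any choice of m observed agents) whose agent-to-agent edges are constrained to the platooning pattern E_{X,X} ⊆ {(x_i, x_{i+k}) : 1 ≤ i ≤ n, 0 ≤ k ≤ p, i + k ≤ n} and which satisfy the agents-only robustness condition: for every unobserved agent x ∈ X, every vertex separator of (x, o) in the collapsed graph G″ has cardinality at least p. The minimum possible number of agent-to-agent edges (self-loops included) over this class equals (n − m)p + n. -/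
/-- The proper out-neighbours of an unobserved agent separate it from `o`. -/
theorem isSeparator_outNeighbors {n m : ℕ} (G : DCS n m) {x : Fin n} (hx : ¬ Observed G x) :
    IsSeparator (colE G) (Sum.inl x) (Sum.inr ())
      (Sum.inl '' {b | G.E (Sum.inl x) (Sum.inl b) ∧ b ≠ x}) := by
  refine ⟨by simp, by simp, fun P hP => ?_⟩
  induction P with
  | nil => simp [IsWalk] at hP
  | cons a t ih =>
    obtain ⟨hchain, hhead, hlast⟩ := hP
    obtain rfl : a = Sum.inl x := by simpa using hhead
    cases t with
    | nil => simp at hlast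
    | cons y t =>
      obtain ⟨hxy, htail⟩ := List.isChain_cons_cons.mp hchain
      rcases y with b | u
      · by_cases hb : b = x
        · subst hb
          obtain ⟨s, hs, hst⟩ := ih ⟨htail, rfl, by simpa using hlast⟩
          exact ⟨s, hs, List.mem_cons_of_mem _ hst⟩
        · exact ⟨Sum.inl b, ⟨b, ⟨hxy, hb⟩, rfl⟩, by simp⟩
      · exact absurd hxy hx

/-- In a robust digraph every unobserved agent has at least `p` proper out-neighbours. -/
theorem RobustX.le_ncard_outNeighbors {n m p : ℕ} {G : DCS n m} (hG : RobustX G p) {x : Fin n}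
    (hx : ¬ Observed G x) : p ≤ {b | G.E (Sum.inl x) (Sum.inl b) ∧ b ≠ x}.ncard := by
  have h := hG x hx _ (isSeparator_outNeighbors G hx)
  rwa [Set.ncard_image_of_injective _ Sum.inl_injective] at h

open Classical in
/-- The number of agent edges is the number of self-loops plus the sum of the proper
out-degrees. -/
theorem agentEdgeCount_eq_sum_s15 {n m : ℕ} (G : DCS n m) :
    agentEdgeCount G =
      ∑ x : Fin n, (1 + {b | G.E (Sum.inl x) (Sum.inl b) ∧ b ≠ x}.ncard) := by
  have hfiber (x : Fin n) : 1 + {b | G.E (Sum.inl x) (Sum.inl b) ∧ b ≠ x}.ncard =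
      (Finset.univ.filter fun b => G.E (Sum.inl x) (Sum.inl b)).card := by
    rw [← Set.ncard_coe_finset, add_comm, ← Set.ncard_insert_of_notMem (a := x) (by simp)]
    congr 1
    ext b
    by_cases hb : b = x
    · subst hb
      simp [G.selfLoop]
    · simp [hb]
  simp_rw [hfiber]
  rw [← Finset.card_sigma, ← Finset.card_map (Equiv.sigmaEquivProd _ _).toEmbedding,
    agentEdgeCount, ← Set.ncard_coe_finset]
  congr 1
  ext ⟨a, b⟩
  simp

open Classical in
theorem card_not_observed {n m : ℕ} (G : DCS n m) :
    (Finset.univ.filter fun x => ¬ Observed G x).card = n - m := by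
  have h : (Finset.univ.filter fun x => Observed G x) = Finset.univ.image G.obs := by
    ext x
    simp only [Finset.mem_filter_univ, Finset.mem_image, Finset.mem_univ, true_and]
    rfl
  rw [← Finset.compl_filter, Finset.card_compl, h, Finset.card_image_of_injective _ G.obs_inj]
  simp

theorem RobustX.le_agentEdgeCount {n m p : ℕ} {G : DCS n m} (hG : RobustX G p) :
    (n - m) * p + n ≤ agentEdgeCount G := by
  classical
  calc (n - m) * p + n = ∑ x : Fin n, (1 + if ¬ Observed G x then p else 0) := by
        rw [Finset.sum_add_distrib, ← Finset.sum_filter, Finset.sum_const (b := p),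
          card_not_observed]
        simp [add_comm]
    _ ≤ agentEdgeCount G := by
        rw [agentEdgeCount_eq_sum_s15]
        gcongr with x
        split_ifs with hx
        · exact Nat.zero_le _
        · exact hG.le_ncard_outNeighbors hx

/-- The platoon whose last `m` agents are observed, every other agent having edges to itself and
to the next `p` agents. -/
def platoon (n m p : ℕ) (hmn : m ≤ n) : DCS n m where
  E
    | Sum.inl a, Sum.inl b => (a : ℕ) ≤ b ∧ (b : ℕ) ≤ a + p ∧ (a = b ∨ (a : ℕ) < n - m)
    | Sum.inl a, Sum.inr j => (a : ℕ) = n - m + j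
    | Sum.inr _, _ => False
  obs j := ⟨n - m + j, by omega⟩
  obs_inj i j h := by
    simp only [Fin.mk.injEq] at h
    omega
  selfLoop i := by simp
  obs_in j i := by simp [Fin.ext_iff]
  obs_noOut j v := by simp

theorem platoon_observed_iff {n m p : ℕ} (hmn : m ≤ n) (x : Fin n) :
    Observed (platoon n m p hmn) x ↔ n - m ≤ (x : ℕ) := by
  constructor
  · rintro ⟨j, rfl⟩
    simp [platoon]
  · intro h
    exact ⟨⟨x - (n - m), by omega⟩, Fin.ext (by simp [platoon]; omega)⟩

/-- Every agent outside a set of fewer than `p` vertices reaches `o` while avoiding that set. -/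
theorem exists_isWalk_platoon {n m p : ℕ} (hpm : p ≤ m) (hmn : m ≤ n) {S : Set (Fin n ⊕ Unit)}
    (hS : S.ncard < p) (ho : Sum.inr () ∉ S) (x : Fin n) (hx : Sum.inl x ∉ S) :
    ∃ P, IsWalk (colE (platoon n m p hmn)) (Sum.inl x) (Sum.inr ()) P ∧ ∀ s ∈ P, s ∉ S := by
  by_cases hobs : n - m ≤ (x : ℕ)
  · refine ⟨[Sum.inl x, Sum.inr ()], ⟨?_, rfl, rfl⟩, by simp [hx, ho]⟩
    exact List.isChain_pair.mpr ((platoon_observed_iff hmn x).mpr hobs)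
  · obtain ⟨k, hk⟩ : ∃ k : Fin p, Sum.inl (⟨x + k + 1, by omega⟩ : Fin n) ∉ S := by
      by_contra! hmem
      have hinj : Function.Injective
          fun k : Fin p => (Sum.inl (⟨x + k + 1, by omega⟩ : Fin n) : Fin n ⊕ Unit) := by
        intro k l h
        simp only [Sum.inl.injEq, Fin.mk.injEq] at h
        omega
      have hle := Set.ncard_le_ncard (Set.range_subset_iff.mpr hmem) S.toFinite
      rw [← Nat.card_coe_set_eq, Nat.card_range_of_injective hinj, Nat.card_fin] at hle
      omega
    obtain ⟨P, ⟨hchain, hhead, hlast⟩, hP⟩ := exists_isWalk_platoon hpm hmn hS ho _ hk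
    refine ⟨Sum.inl x :: P, ⟨?_, rfl, ?_⟩, by simpa [hx] using hP⟩
    · refine List.isChain_cons.mpr ⟨fun y hy => ?_, hchain⟩
      obtain rfl : Sum.inl _ = y := by simpa [hhead] using hy
      simp only [colE, platoon]
      omega
    · simp [List.getLast?_cons, hlast]
termination_by n - x

theorem robustX_platoon {n m p : ℕ} (hpm : p ≤ m) (hmn : m ≤ n) :
    RobustX (platoon n m p hmn) p := by
  rintro x - S ⟨hx, ho, hsep⟩
  by_contra! hS
  obtain ⟨P, hP, hPS⟩ := exists_isWalk_platoon hpm hmn hS ho x hx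
  obtain ⟨s, hs, hsP⟩ := hsep P hP
  exact hPS s hsP hs

theorem agentEdgeCount_platoon {n m p : ℕ} (hpm : p ≤ m) (hmn : m ≤ n) :
    agentEdgeCount (platoon n m p hmn) = (n - m) * p + n := by
  refine le_antisymm ?_ (robustX_platoon hpm hmn).le_agentEdgeCount
  have hsub : {e : Fin n × Fin n | (platoon n m p hmn).E (Sum.inl e.1) (Sum.inl e.2)} ⊆
      Set.range (Sum.elim (fun x : Fin n => (x, x)) fun q : Fin (n - m) × Fin p =>
        ((⟨q.1, by omega⟩, ⟨q.1 + q.2 + 1, by omega⟩) : Fin n × Fin n)) := by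
    rintro ⟨a, b⟩ ⟨hab, hba, h⟩
    by_cases heq : a = b
    · exact ⟨Sum.inl a, by simp [heq]⟩
    · have hlt := h.resolve_left heq
      have hne := Fin.val_ne_of_ne heq
      simp only at hab hba hlt
      refine ⟨Sum.inr (⟨a, hlt⟩, ⟨b - a - 1, by omega⟩), ?_⟩
      simp only [Sum.elim_inr, Prod.mk.injEq, Fin.ext_iff, true_and]
      omega
  calc agentEdgeCount (platoon n m p hmn) ≤ _ := Set.ncard_le_ncard hsub (Set.toFinite _)
    _ ≤ Nat.card (Fin n ⊕ Fin (n - m) × Fin p) := by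
        rw [← Nat.card_coe_set_eq]
        exact Finite.card_range_le _
    _ = (n - m) * p + n := by simp [add_comm]

/-- Over all DCS digraphs on `n` agents and `m` observers whose agent-to-agent edges
obey the platooning pattern (an edge from `x_i` only to some `x_{i+k}` with
`0 ≤ k ≤ p`) and which are robust to all feasible agent-only attacks of size at most
`p`, the minimum possible number of agent-to-agent edges (self-loops included) equals
`(n - m)p + n`. -/
theorem min_edges_platooning_agentsOnly {n m p : ℕ} (hp : 1 ≤ p) (hpm : p ≤ m)
    (hmn : m ≤ n) :
    IsLeast {k : ℕ | ∃ G : DCS n m,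
      (∀ a b : Fin n, G.E (Sum.inl a) (Sum.inl b) →
        (a : ℕ) ≤ (b : ℕ) ∧ (b : ℕ) ≤ (a : ℕ) + p) ∧
      RobustX G p ∧ agentEdgeCount G = k} ((n - m) * p + n) := by
  refine ⟨⟨platoon n m p hmn, fun a b h => ⟨h.1, h.2.1⟩, robustX_platoon hpm hmn,
    agentEdgeCount_platoon hpm hmn⟩, ?_⟩
  rintro k ⟨G, -, hG, rfl⟩
  exact hG.le_agentEdgeCount
end
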